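/- arXiv:1311.3240 — 2 statements merged into one kernel-verified Lean document; each statement's English description precedes it below -/
import Mathlib

section
/- Let n be a positive integer and let 𝒜ₙ be a nonempty bridge-alterable set of simple graphs on vertex set {1,…,n}. Then |{G ∈ 𝒜ₙ : G is connected}| / |𝒜ₙ| ≥ min over integers t with n/3 < t ≤ n of |𝒯ₜ| / |ℱₜ|. (That is, the probability that a uniformly random graph from 𝒜ₙ is connected is at least the minimum over n/3 < t ≤ n of the probability that a uniformly random forest on {1,…,t} is connected.) -/
/-- A set of simple graphs on a fixed vertex set is bridge-alterable if for every
graph `G` and every bridge `e` of `G`, `G` is in the set iff `G - e` is. -/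
def BridgeAlterable {n : ℕ} (A : Set (SimpleGraph (Fin n))) : Prop :=
  ∀ (G : SimpleGraph (Fin n)) (e : Sym2 (Fin n)), G.IsBridge e →
    (G ∈ A ↔ G.deleteEdges {e} ∈ A)

/-- The number of trees on vertex set `{1,…,t}`. -/
noncomputable def treeCount (t : ℕ) : ℕ :=
  {T : SimpleGraph (Fin t) | T.IsTree}.ncard

/-- The number of forests on vertex set `{1,…,t}`. -/
noncomputable def forestCount (t : ℕ) : ℕ :=
  {F : SimpleGraph (Fin t) | F.IsAcyclic}.ncard

namespace SimpleGraph

variable {V : Type*}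

theorem reachable_sup_edge_iff {G : SimpleGraph V} {x y a b : V} :
    (G ⊔ edge x y).Reachable a b ↔
      G.Reachable a b ∨ (G.Reachable a x ∧ G.Reachable y b) ∨
        (G.Reachable a y ∧ G.Reachable x b) := by
  constructor
  · rintro ⟨p⟩
    induction p with
    | nil => exact Or.inl .rfl
    | @cons a c b h p ih =>
      rw [sup_adj, edge_adj] at h
      rcases h with h | ⟨⟨rfl, rfl⟩ | ⟨rfl, rfl⟩, -⟩
      · have h' : G.Reachable a c := h.reachable
        rcases ih with ih | ⟨h₁, h₂⟩ | ⟨h₁, h₂⟩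
        · exact Or.inl (h'.trans ih)
        · exact Or.inr (Or.inl ⟨h'.trans h₁, h₂⟩)
        · exact Or.inr (Or.inr ⟨h'.trans h₁, h₂⟩)
      · rcases ih with ih | ⟨h₁, h₂⟩ | ⟨h₁, h₂⟩
        · exact Or.inr (Or.inl ⟨.rfl, ih⟩)
        · exact Or.inr (Or.inl ⟨.rfl, h₂⟩)
        · exact Or.inl h₂
      · rcases ih with ih | ⟨h₁, h₂⟩ | ⟨h₁, h₂⟩
        · exact Or.inr (Or.inr ⟨.rfl, ih⟩)
        · exact Or.inl h₂
        · exact Or.inr (Or.inr ⟨.rfl, h₂⟩)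
  · have hxy : (G ⊔ edge x y).Reachable x y := by
      by_cases h : x = y
      · exact h ▸ .rfl
      · exact Adj.reachable (by simp [edge_adj, h])
    have hle : G ≤ G ⊔ edge x y := le_sup_left
    rintro (h | ⟨h₁, h₂⟩ | ⟨h₁, h₂⟩)
    · exact h.mono hle
    · exact (h₁.mono hle).trans (hxy.trans (h₂.mono hle))
    · exact (h₁.mono hle).trans (hxy.symm.trans (h₂.mono hle))

theorem connected_congr {F F' : SimpleGraph V} (h : F.Reachable = F'.Reachable) :
    F.Connected ↔ F'.Connected := by
  simp only [connected_iff, Preconnected, h]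

/-- The reachability relation of `G ⊔ edge u v` depends only on the components of `u` and `v`. -/
theorem reachable_sup_edge_congr {G : SimpleGraph V} {u v x y : V} (hux : G.Reachable u x)
    (hvy : G.Reachable v y) : (G ⊔ edge u v).Reachable = (G ⊔ edge x y).Reachable := by
  ext a b
  rw [reachable_sup_edge_iff, reachable_sup_edge_iff]
  have hu : ∀ c, G.Reachable c u ↔ G.Reachable c x := fun c ↦
    ⟨fun h ↦ h.trans hux, fun h ↦ h.trans hux.symm⟩
  have hv : ∀ c, G.Reachable c v ↔ G.Reachable c y := fun c ↦
    ⟨fun h ↦ h.trans hvy, fun h ↦ h.trans hvy.symm⟩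
  simp only [hu, hv, reachable_comm (u := u) (v := b), reachable_comm (u := v) (v := b),
    reachable_comm (u := x) (v := b), reachable_comm (u := y) (v := b)]

theorem sdiff_edge_sup_edge {G : SimpleGraph V} {x y : V} (h : G.Adj x y) :
    G \ edge x y ⊔ edge x y = G := by
  rw [sdiff_sup_self, sup_edge_of_adj _ h]

theorem sup_edge_sdiff_edge {G : SimpleGraph V} {x y : V} (h : ¬ G.Adj x y) :
    (G ⊔ edge x y) \ edge x y = G := by
  rw [sup_sdiff_right_self, sdiff_edge _ h]

theorem IsAcyclic.not_reachable_sdiff_edge {G : SimpleGraph V} (hG : G.IsAcyclic) {x y : V}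
    (h : G.Adj x y) : ¬ (G \ edge x y).Reachable x y :=
  isBridge_iff.1 (isAcyclic_iff_forall_adj_isBridge.1 hG h)

/-- A walk into the `H`-component of `u` enters it through some edge `xz`, the part of the walk
before that edge avoiding the component. -/
theorem Walk.exists_adj_entering {F H : SimpleGraph V} {u v : V} (p : F.Walk v u)
    (hv : ¬ H.Reachable u v) :
    ∃ x z, F.Adj x z ∧ H.Reachable u z ∧ ¬ H.Reachable u x ∧ (F \ edge x z).Reachable v x := by
  suffices h : ∃ x z, F.Adj x z ∧ H.Reachable u z ∧ ¬ H.Reachable u x ∧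
      (F.deleteEdges {e | ∃ z ∈ e, H.Reachable u z}).Reachable v x by
    obtain ⟨x, z, h₁, h₂, h₃, h₄⟩ := h
    refine ⟨x, z, h₁, h₂, h₃, h₄.mono ?_⟩
    rintro a b hab
    simp only [deleteEdges_adj, Set.mem_ofPred_eq, not_exists, not_and, Sym2.mem_iff] at hab
    simp only [sdiff_adj, edge_adj]
    refine ⟨hab.1, ?_⟩
    rintro ⟨⟨rfl, rfl⟩ | ⟨rfl, rfl⟩, -⟩
    · exact hab.2 _ (Or.inr rfl) h₂
    · exact hab.2 _ (Or.inl rfl) h₂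
  induction p with
  | nil => exact absurd .rfl hv
  | @cons v w u h p ih =>
    by_cases hw : H.Reachable u w
    · exact ⟨v, w, h, hw, hv, .rfl⟩
    · obtain ⟨x, z, h₁, h₂, h₃, h₄⟩ := ih hw
      refine ⟨x, z, h₁, h₂, h₃, Reachable.trans (Adj.reachable ?_) h₄⟩
      simp only [deleteEdges_adj, Set.mem_ofPred_eq, not_exists, not_and, Sym2.mem_iff]
      refine ⟨h, ?_⟩
      rintro _ (rfl | rfl)
      · exact hv
      · exact hw

/-- An edge joining the component of `v` to the `H`-component of `u` can be recovered from the
graph obtained by adding it. -/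
theorem sup_edge_injective {H F₁ F₂ : SimpleGraph V} {u v x₁ x₂ z₁ z₂ : V}
    (h₁ : H ≤ F₁) (h₂ : H ≤ F₂) (huv₁ : ¬ F₁.Reachable u v) (huv₂ : ¬ F₂.Reachable u v)
    (hx₁ : F₁.Reachable v x₁) (hx₂ : F₂.Reachable v x₂)
    (hz₁ : H.Reachable u z₁) (hz₂ : H.Reachable u z₂)
    (h : F₁ ⊔ edge x₁ z₁ = F₂ ⊔ edge x₂ z₂) : F₁ = F₂ ∧ x₁ = x₂ ∧ z₁ = z₂ := by
  have hxz₁ : ¬ F₁.Adj x₁ z₁ := fun hadj ↦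
    huv₁ ((hz₁.mono h₁).trans (hadj.reachable.symm.trans hx₁.symm))
  have hxz₂ : ¬ F₂.Adj x₂ z₂ := fun hadj ↦
    huv₂ ((hz₂.mono h₂).trans (hadj.reachable.symm.trans hx₂.symm))
  have hne₂ : x₂ ≠ z₂ := fun e ↦ huv₂ ((hz₂.mono h₂).trans (e ▸ hx₂.symm))
  have key : x₁ = x₂ ∧ z₁ = z₂ := by
    by_contra hcon
    have hadj : F₁.Adj x₂ z₂ := by
      have : (F₁ ⊔ edge x₁ z₁).Adj x₂ z₂ := by
        rw [h]; simp [edge_adj, hne₂]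
      rw [sup_adj, edge_adj] at this
      rcases this with this | ⟨⟨rfl, rfl⟩ | ⟨rfl, rfl⟩, -⟩
      · exact this
      · exact absurd ⟨rfl, rfl⟩ hcon
      · exact absurd ((hz₁.mono h₂).trans hx₂.symm) huv₂
    have hle : F₂ ≤ F₁ ⊓ F₂ ⊔ edge x₁ z₁ := by
      intro a b hab
      have : (F₁ ⊔ edge x₁ z₁).Adj a b := by rw [h]; exact Or.inl hab
      rcases this with this | this
      · exact Or.inl ⟨this, hab⟩
      · exact Or.inr this
    rcases reachable_sup_edge_iff.1 (hx₂.mono hle) with h' | ⟨h', h''⟩ | ⟨h', h''⟩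
    · exact huv₁ ((hz₂.mono h₁).trans (hadj.reachable.symm.trans (h'.mono inf_le_left).symm))
    · exact huv₂ ((hz₁.mono h₂).trans ((h''.mono inf_le_right).trans hx₂.symm))
    · exact huv₂ ((hz₁.mono h₂).trans (h'.mono inf_le_right).symm)
  obtain ⟨rfl, rfl⟩ := key
  refine ⟨?_, rfl, rfl⟩
  rw [← sup_edge_sdiff_edge hxz₁, h, sup_edge_sdiff_edge hxz₂]

theorem Reachable.of_forall_adj {G G' : SimpleGraph V} (h : ∀ a b, G.Adj a b → G'.Reachable a b)
    {x y : V} (hxy : G.Reachable x y) : G'.Reachable x y := by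
  obtain ⟨p⟩ := hxy
  induction p with
  | nil => exact .rfl
  | cons hab _ ih => exact (h _ _ hab).trans ih

/-- `G` is obtained from `B` by adding edges that are bridges of `G`. -/
def IsBridgeExtension (B G : SimpleGraph V) : Prop :=
  B ≤ G ∧ ∀ ⦃x y⦄, (G \ B).Adj x y → G.IsBridge s(x, y)

namespace IsBridgeExtension

variable {B G H : SimpleGraph V}

theorem isAcyclic (h : H.IsBridgeExtension G) (hH : H.IsAcyclic) : G.IsAcyclic := by
  intro v p hp
  have hmem : ∀ e ∈ p.edges, e ∈ H.edgeSet := by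
    intro e he
    induction e with
    | h x y =>
      by_contra hxy
      exact (h.2 ⟨p.edges_subset_edgeSet he, hxy⟩).notMem_edges_of_isCycle hp he
  exact hH _ (hp.transfer hmem)

theorem _root_.SimpleGraph.IsAcyclic.isBridgeExtension (hG : G.IsAcyclic) (h : H ≤ G) :
    H.IsBridgeExtension G :=
  ⟨h, fun _ _ hxy ↦ isAcyclic_iff_forall_adj_isBridge.1 hG hxy.1⟩

theorem isBridge_sup (h : B.IsBridgeExtension G) (hr : H.Reachable = B.Reachable) {x y : V}
    (hxy : (G \ B).Adj x y) : (H ⊔ G \ B).IsBridge s(x, y) := by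
  rw [isBridge_iff]
  refine fun hreach ↦ isBridge_iff.1 (h.2 hxy) (Reachable.of_forall_adj (fun a b hab ↦ ?_) hreach)
  rw [deleteEdges_adj] at hab
  rcases hab with ⟨hab | hab, hne⟩
  · have hB : B.Reachable a b := hr ▸ hab.reachable
    refine hB.mono fun c d hcd ↦ deleteEdges_adj.2 ⟨h.1 hcd, fun he ↦ hxy.2 ?_⟩
    exact (adj_congr_of_sym2 B he).1 hcd
  · exact (deleteEdges_adj.2 ⟨hab.1, hne⟩ : (G.deleteEdges {s(x, y)}).Adj a b).reachable

theorem not_adj (h : B.IsBridgeExtension G) (hr : H.Reachable = B.Reachable) {x y : V}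
    (hxy : (G \ B).Adj x y) : ¬ H.Adj x y := by
  intro hadj
  have hB : B.Reachable x y := hr ▸ hadj.reachable
  refine isBridge_iff.1 (h.2 hxy) (hB.mono fun c d hcd ↦ deleteEdges_adj.2 ⟨h.1 hcd, fun he ↦ ?_⟩)
  exact hxy.2 ((adj_congr_of_sym2 B he).1 hcd)

theorem sup_sdiff (h : B.IsBridgeExtension G) (hr : H.Reachable = B.Reachable) :
    H.IsBridgeExtension (H ⊔ G \ B) :=
  ⟨le_sup_left, fun _ _ hxy ↦ h.isBridge_sup hr (hxy.1.resolve_left hxy.2)⟩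

theorem sup_sdiff_sdiff (h : B.IsBridgeExtension G) (hr : H.Reachable = B.Reachable) :
    (H ⊔ G \ B) \ H = G \ B := by
  ext x y
  exact ⟨fun hxy ↦ hxy.1.resolve_left hxy.2, fun hxy ↦ ⟨Or.inr hxy, h.not_adj hr hxy⟩⟩

theorem reachable_sup_sdiff (h : B.IsBridgeExtension G) (hr : H.Reachable = B.Reachable) :
    (H ⊔ G \ B).Reachable = G.Reachable := by
  ext x y
  constructor
  · refine Reachable.of_forall_adj ?_
    rintro a b (hab | hab)
    · exact (hr ▸ hab.reachable : B.Reachable a b).mono h.1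
    · exact hab.1.reachable
  · refine Reachable.of_forall_adj fun a b hab ↦ ?_
    by_cases hB : B.Adj a b
    · exact (hr.symm ▸ hB.reachable : H.Reachable a b).mono le_sup_left
    · exact Adj.reachable (Or.inr ⟨hab, hB⟩)

end IsBridgeExtension

/-- The graph obtained by deleting all bridges. -/
def bridgelessCore (G : SimpleGraph V) : SimpleGraph V :=
  G.deleteEdges {e | G.IsBridge e}

theorem isBridgeExtension_bridgelessCore (G : SimpleGraph V) :
    G.bridgelessCore.IsBridgeExtension G := by
  refine ⟨deleteEdges_le _, fun x y hxy ↦ ?_⟩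
  by_contra h
  exact hxy.2 (deleteEdges_adj.2 ⟨hxy.1, h⟩)

theorem not_isBridge_bridgelessCore {G : SimpleGraph V} {e : Sym2 V}
    (he : e ∈ G.bridgelessCore.edgeSet) : ¬ G.bridgelessCore.IsBridge e := by
  rw [bridgelessCore, edgeSet_deleteEdges] at he
  have hnb : ¬ G.IsBridge e := he.2
  rw [isBridge_iff_forall_cycle_notMem he.1] at hnb
  push Not at hnb
  obtain ⟨u, p, hp, hep⟩ := hnb
  have hmem : ∀ f ∈ p.edges, f ∈ G.bridgelessCore.edgeSet := by
    intro f hf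
    rw [bridgelessCore, edgeSet_deleteEdges]
    exact ⟨p.edges_subset_edgeSet hf, fun hb ↦ IsBridge.notMem_edges_of_isCycle hb hp hf⟩
  intro hb
  refine hb.notMem_edges_of_isCycle (hp.transfer hmem) ?_
  rwa [Walk.edges_transfer]

theorem bridgelessCore_eq_bridgelessCore_iff {G G' : SimpleGraph V} :
    G'.bridgelessCore = G.bridgelessCore ↔ G.bridgelessCore.IsBridgeExtension G' := by
  refine ⟨fun h ↦ h ▸ isBridgeExtension_bridgelessCore G', fun h ↦ ?_⟩
  ext x y
  constructor
  · intro hxy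
    have hxy' := deleteEdges_adj.1 hxy
    by_contra hn
    exact hxy'.2 (h.2 ⟨hxy'.1, hn⟩)
  · exact fun hxy ↦ deleteEdges_adj.2
      ⟨h.1 hxy, fun hb ↦ not_isBridge_bridgelessCore hxy (IsBridge.anti h.1 hb)⟩

section Counting

variable [Fintype V]

open Finset
open scoped Classical

/-- The forests on `V` that contain `H`. -/
noncomputable def forestsAbove (H : SimpleGraph V) : Finset (SimpleGraph V) :=
  {F | F.IsAcyclic ∧ H ≤ F}

/-- The vertex set of the component of `v`, as a finset. -/
noncomputable def compFinset (G : SimpleGraph V) (v : V) : Finset V :=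
  {x | G.Reachable v x}

theorem mem_forestsAbove {H F : SimpleGraph V} :
    F ∈ H.forestsAbove ↔ F.IsAcyclic ∧ H ≤ F := by
  simp [forestsAbove]

theorem mem_compFinset {G : SimpleGraph V} {v x : V} :
    x ∈ G.compFinset v ↔ G.Reachable v x := by
  simp [compFinset]

/-- Double counting of the forests containing `H` in which `u` and `v` are joined, according to
the edge by which the path from `v` enters the `H`-component of `u`. -/
theorem card_mul_sum_not_reachable (H : SimpleGraph V) {u v : V} (huv : ¬ H.Reachable u v)
    (φ : SimpleGraph V → ℝ) (hφ : ∀ F F' : SimpleGraph V, F.Reachable = F'.Reachable → φ F = φ F') :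
    (#(H.compFinset u) : ℝ) *
        ∑ F ∈ H.forestsAbove with ¬ F.Reachable u v, #(F.compFinset v) * φ (F ⊔ edge u v) =
      ∑ F ∈ H.forestsAbove with F.Reachable u v, φ F := by
  calc
    _ = ∑ F ∈ H.forestsAbove with ¬ F.Reachable u v,
          ∑ _q ∈ F.compFinset v ×ˢ H.compFinset u, φ (F ⊔ edge u v) := by
      rw [mul_sum]
      refine sum_congr rfl fun F _ ↦ ?_
      rw [sum_const, card_product, nsmul_eq_mul]
      push_cast
      ring
    _ = ∑ F ∈ H.forestsAbove with F.Reachable u v, φ F := by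
      rw [sum_sigma']
      refine sum_bij (fun q _ ↦ q.1 ⊔ edge q.2.1 q.2.2) ?_ ?_ ?_ ?_
      · rintro ⟨F, x, z⟩ h
        simp only [mem_sigma, mem_filter, mem_forestsAbove, mem_product, mem_compFinset] at h ⊢
        obtain ⟨⟨⟨hF, hle⟩, hn⟩, hx, hz⟩ := h
        refine ⟨⟨IsAcyclic.sup_edge_of_not_reachable (fun hxz ↦ hn ?_) hF,
          hle.trans le_sup_left⟩, reachable_sup_edge_iff.2 (Or.inr (Or.inr ⟨hz.mono hle, hx.symm⟩))⟩
        exact (hz.mono hle).trans (hxz.symm.trans hx.symm)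
      · rintro ⟨F₁, x₁, z₁⟩ h₁ ⟨F₂, x₂, z₂⟩ h₂ h
        simp only [mem_sigma, mem_filter, mem_forestsAbove, mem_product, mem_compFinset] at h₁ h₂
        obtain ⟨rfl, rfl, rfl⟩ := sup_edge_injective h₁.1.1.2 h₂.1.1.2 h₁.1.2 h₂.1.2
          h₁.2.1 h₂.2.1 h₁.2.2 h₂.2.2 h
        rfl
      · intro K hK
        simp only [mem_filter, mem_forestsAbove] at hK
        obtain ⟨⟨hac, hle⟩, hr⟩ := hK
        obtain ⟨p⟩ := hr.symm
        obtain ⟨x, z, hxz, hz, hx, hvx⟩ := p.exists_adj_entering huv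
        have hHle : H ≤ K \ edge x z := by
          intro a b hab
          refine ⟨hle hab, ?_⟩
          rw [edge_adj]
          rintro ⟨⟨rfl, rfl⟩ | ⟨rfl, rfl⟩, -⟩
          · exact hx (hz.trans hab.reachable.symm)
          · exact hx (hz.trans hab.reachable)
        refine ⟨⟨K \ edge x z, x, z⟩, ?_, sdiff_edge_sup_edge hxz⟩
        simp only [mem_sigma, mem_filter, mem_forestsAbove, mem_product, mem_compFinset]
        refine ⟨⟨⟨hac.anti sdiff_le, hHle⟩, fun h ↦ hac.not_reachable_sdiff_edge hxz ?_⟩, hvx, hz⟩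
        exact hvx.symm.trans (h.symm.trans (hz.mono hHle))
      · rintro ⟨F, x, z⟩ h
        simp only [mem_sigma, mem_filter, mem_forestsAbove, mem_product, mem_compFinset] at h
        refine hφ _ _ ?_
        dsimp only
        rw [edge_comm x z]
        exact reachable_sup_edge_congr (h.2.2.mono h.1.1.2) h.2.1

theorem compFinset_congr {F F' : SimpleGraph V} (h : F.Reachable = F'.Reachable) (v : V) :
    F.compFinset v = F'.compFinset v := by
  simp only [compFinset, h]

theorem Reachable.compFinset_eq {F : SimpleGraph V} {x y : V} (h : F.Reachable x y) :
    F.compFinset x = F.compFinset y := by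
  ext a
  simp only [mem_compFinset]
  exact ⟨h.symm.trans, h.trans⟩

theorem card_compFinset_pos (F : SimpleGraph V) (v : V) : 0 < #(F.compFinset v) :=
  card_pos.2 ⟨v, mem_compFinset.2 .rfl⟩

theorem card_compFinset_sup_edge {F : SimpleGraph V} {x y : V} (h : ¬ F.Reachable x y) :
    #((F ⊔ edge x y).compFinset x) = #(F.compFinset x) + #(F.compFinset y) := by
  rw [← card_union_of_disjoint]
  · congr 1
    ext a
    simp only [mem_union, mem_compFinset, reachable_sup_edge_iff]
    constructor
    · rintro (h' | ⟨-, h'⟩ | ⟨h', -⟩)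
      · exact Or.inl h'
      · exact Or.inr h'
      · exact absurd h' h
    · rintro (h' | h')
      · exact Or.inl h'
      · exact Or.inr (Or.inl ⟨.rfl, h'⟩)
  · rw [Finset.disjoint_left]
    intro a hx hy
    exact h ((mem_compFinset.1 hx).trans (mem_compFinset.1 hy).symm)

theorem sum_ratio_card_compFinset_le (H : SimpleGraph V) (u x y : V) :
    ∑ F ∈ H.forestsAbove, (if ¬ F.Reachable x y ∧ ¬ F.Reachable u x ∧ ¬ F.Reachable u y then
        (#(F.compFinset y) : ℝ) / (#(F.compFinset x) + #(F.compFinset y)) else 0) ≤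
      ∑ F ∈ H.forestsAbove, (if F.Reachable x y ∧ ¬ F.Reachable u x then
        1 / (#(F.compFinset x) : ℝ) else 0) := by
  by_cases hxy : H.Reachable x y
  · refine sum_le_sum fun F hF ↦ ?_
    rw [if_neg fun h ↦ h.1 (hxy.mono (mem_forestsAbove.1 hF).2)]
    split_ifs <;> positivity
  let φ : SimpleGraph V → ℝ := fun F ↦ if F.Reachable u x then 0 else 1 / (#(F.compFinset x) : ℝ)
  have hφ₀ : ∀ F, 0 ≤ φ F := fun F ↦ by
    dsimp only [φ]
    split_ifs <;> positivity
  have key := card_mul_sum_not_reachable H hxy φ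
    (fun F F' h ↦ by simp only [φ, h, compFinset_congr h])
  have hR : ∑ F ∈ H.forestsAbove, (if F.Reachable x y ∧ ¬ F.Reachable u x then
        1 / (#(F.compFinset x) : ℝ) else 0) = ∑ F ∈ H.forestsAbove with F.Reachable x y, φ F := by
    rw [sum_filter]
    refine sum_congr rfl fun F _ ↦ ?_
    by_cases h₁ : F.Reachable x y <;> by_cases h₂ : F.Reachable u x <;> simp [φ, h₁, h₂]
  have hL : ∑ F ∈ H.forestsAbove,
        (if ¬ F.Reachable x y ∧ ¬ F.Reachable u x ∧ ¬ F.Reachable u y then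
        (#(F.compFinset y) : ℝ) / (#(F.compFinset x) + #(F.compFinset y)) else 0) =
      ∑ F ∈ H.forestsAbove with ¬ F.Reachable x y, #(F.compFinset y) * φ (F ⊔ edge x y) := by
    rw [sum_filter]
    refine sum_congr rfl fun F _ ↦ ?_
    by_cases h₁ : F.Reachable x y
    · simp [h₁]
    have h₂ : (F ⊔ edge x y).Reachable u x ↔ F.Reachable u x ∨ F.Reachable u y := by
      rw [reachable_sup_edge_iff]
      constructor
      · rintro (h | ⟨h, -⟩ | ⟨h, -⟩)
        exacts [Or.inl h, Or.inl h, Or.inr h]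
      · rintro (h | h)
        exacts [Or.inl h, Or.inr (Or.inr ⟨h, .rfl⟩)]
    simp only [φ, card_compFinset_sup_edge h₁]
    by_cases h₃ : F.Reachable u x <;> by_cases h₄ : F.Reachable u y <;>
      simp [h₁, h₂, h₃, h₄, div_eq_mul_inv]
  rw [hL, hR, ← key]
  have hone : (1 : ℝ) ≤ #(H.compFinset x) := by exact_mod_cast card_compFinset_pos H x
  exact le_mul_of_one_le_left
    (sum_nonneg fun F _ ↦ mul_nonneg (Nat.cast_nonneg _) (hφ₀ _)) hone

/-- The number of pairs `x, y` such that `u, x, y` lie in three different components is, on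
average, at most twice the number of vertices outside the component of `u`. -/
theorem sum_card_three_components_le (H : SimpleGraph V) (u : V) :
    ∑ F ∈ H.forestsAbove, ∑ x, ∑ y,
        (if ¬ F.Reachable x y ∧ ¬ F.Reachable u x ∧ ¬ F.Reachable u y then (1 : ℝ) else 0) ≤
      2 * ∑ F ∈ H.forestsAbove, ∑ x, (if ¬ F.Reachable u x then (1 : ℝ) else 0) := by
  have hpair : ∀ x y, ∑ F ∈ H.forestsAbove,
        (if ¬ F.Reachable x y ∧ ¬ F.Reachable u x ∧ ¬ F.Reachable u y then (1 : ℝ) else 0) ≤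
      2 * ∑ F ∈ H.forestsAbove, (if F.Reachable x y ∧ ¬ F.Reachable u x then
        1 / (#(F.compFinset x) : ℝ) else 0) := by
    intro x y
    have h₁ := sum_ratio_card_compFinset_le H u x y
    have h₂ := sum_ratio_card_compFinset_le H u y x
    have hL := sum_congr (rfl : H.forestsAbove = H.forestsAbove) fun F _ ↦
      show (if ¬ F.Reachable x y ∧ ¬ F.Reachable u x ∧ ¬ F.Reachable u y then (1 : ℝ) else 0) =
        (if ¬ F.Reachable x y ∧ ¬ F.Reachable u x ∧ ¬ F.Reachable u y then
          (#(F.compFinset y) : ℝ) / (#(F.compFinset x) + #(F.compFinset y)) else 0) +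
        (if ¬ F.Reachable y x ∧ ¬ F.Reachable u y ∧ ¬ F.Reachable u x then
          (#(F.compFinset x) : ℝ) / (#(F.compFinset y) + #(F.compFinset x)) else 0) by
        simp only [reachable_comm (u := y) (v := x), and_comm (a := ¬ F.Reachable u y)]
        split_ifs with h
        · have := card_compFinset_pos F x
          field_simp
          ring
        · simp
    have hR : ∑ F ∈ H.forestsAbove, (if F.Reachable y x ∧ ¬ F.Reachable u y then
        1 / (#(F.compFinset y) : ℝ) else 0) =
        ∑ F ∈ H.forestsAbove, (if F.Reachable x y ∧ ¬ F.Reachable u x then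
        1 / (#(F.compFinset x) : ℝ) else 0) := by
      refine sum_congr rfl fun F _ ↦ ?_
      by_cases h : F.Reachable x y
      · have hu : F.Reachable u y ↔ F.Reachable u x := ⟨fun k ↦ k.trans h.symm, fun k ↦ k.trans h⟩
        simp only [h.compFinset_eq, hu, h, h.symm]
      · simp [h, reachable_comm (u := y) (v := x)]
    rw [hL, sum_add_distrib]
    linarith
  calc
    _ = ∑ x, ∑ y, ∑ F ∈ H.forestsAbove,
        (if ¬ F.Reachable x y ∧ ¬ F.Reachable u x ∧ ¬ F.Reachable u y then (1 : ℝ) else 0) := by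
      rw [sum_comm]
      exact sum_congr rfl fun x _ ↦ sum_comm
    _ ≤ ∑ x, ∑ y, 2 * ∑ F ∈ H.forestsAbove, (if F.Reachable x y ∧ ¬ F.Reachable u x then
        1 / (#(F.compFinset x) : ℝ) else 0) :=
      sum_le_sum fun x _ ↦ sum_le_sum fun y _ ↦ hpair x y
    _ = 2 * ∑ F ∈ H.forestsAbove, ∑ x, ∑ y, (if F.Reachable x y ∧ ¬ F.Reachable u x then
        1 / (#(F.compFinset x) : ℝ) else 0) := by
      simp only [← mul_sum]
      congr 1
      rw [sum_comm (s := H.forestsAbove)]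
      exact sum_congr rfl fun x _ ↦ sum_comm
    _ = _ := by
      congr 1
      refine sum_congr rfl fun F _ ↦ sum_congr rfl fun x _ ↦ ?_
      by_cases h : F.Reachable u x
      · simp [h]
      · have := card_compFinset_pos F x
        simp only [h, not_false_eq_true, and_true, if_true]
        rw [← sum_filter, sum_const, nsmul_eq_mul]
        change (#(F.compFinset x) : ℝ) * _ = 1
        field_simp

/-- In a random forest containing `H`, the expected number of vertices outside the component of
`u` is at most `s / (s - 1)`, where `s` is the order of the `H`-component of `u`. -/
theorem sum_card_outside_le (H : SimpleGraph V) (u : V) :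
    ((#(H.compFinset u) : ℝ) - 1) *
        ∑ F ∈ H.forestsAbove, ∑ x, (if ¬ F.Reachable u x then (1 : ℝ) else 0) ≤
      (#(H.compFinset u) : ℝ) * #H.forestsAbove := by
  set s : ℝ := (#(H.compFinset u) : ℝ) with hs
  set O : ℝ := ∑ F ∈ H.forestsAbove, ∑ x, (if ¬ F.Reachable u x then (1 : ℝ) else 0) with hO
  set M : ℝ := (#H.forestsAbove : ℝ)
  set n : ℝ := (Fintype.card V : ℝ) with hn
  have hcard : ∀ F : SimpleGraph V,
      (#(F.compFinset u) : ℝ) = n - ∑ x, (if ¬ F.Reachable u x then (1 : ℝ) else 0) := by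
    intro F
    rw [eq_sub_iff_add_eq, hn, ← card_univ, ← sum_filter, sum_const, nsmul_eq_mul, mul_one,
      compFinset]
    exact_mod_cast card_filter_add_card_filter_not (s := univ) (fun x ↦ F.Reachable u x)
  have hP : ∑ y with ¬ H.Reachable u y, ∑ F ∈ H.forestsAbove with F.Reachable u y, (1 : ℝ) =
      (n - s) * M - O := by
    have hF : ∀ F ∈ H.forestsAbove, ∑ y with ¬ H.Reachable u y,
        (if F.Reachable u y then (1 : ℝ) else 0) = #(F.compFinset u) - s := by
      intro F hF
      rw [eq_sub_iff_add_eq, hs, compFinset, compFinset, card_eq_sum_ones, card_eq_sum_ones]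
      push_cast
      rw [sum_filter, sum_filter, sum_filter, ← sum_add_distrib]
      refine sum_congr rfl fun y _ ↦ ?_
      by_cases h : H.Reachable u y
      · simp [h, h.mono (mem_forestsAbove.1 hF).2]
      · simp [h]
    simp only [sum_filter (s := H.forestsAbove)]
    rw [sum_comm, sum_congr rfl hF]
    simp only [hcard, sum_sub_distrib, sum_const, nsmul_eq_mul]
    rw [← hO]
    ring
  have hdbl : ∀ y, ¬ H.Reachable u y → s * ∑ F ∈ H.forestsAbove with ¬ F.Reachable u y,
      (#(F.compFinset y) : ℝ) = ∑ F ∈ H.forestsAbove with F.Reachable u y, (1 : ℝ) := fun y hy ↦ by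
    simpa using card_mul_sum_not_reachable H hy (fun _ ↦ 1) (fun _ _ _ ↦ rfl)
  have hdbl' : ∀ y, ¬ H.Reachable u y → ∑ F ∈ H.forestsAbove with ¬ F.Reachable u y,
      (#(F.compFinset u) : ℝ) ≤ ∑ F ∈ H.forestsAbove with F.Reachable u y, (1 : ℝ) := fun y hy ↦ by
    have h := card_mul_sum_not_reachable H (fun h ↦ hy h.symm) (fun _ ↦ 1) (fun _ _ _ ↦ rfl)
    simp only [mul_one, reachable_comm (u := y)] at h
    have hone : (1 : ℝ) ≤ #(H.compFinset y) := by exact_mod_cast card_compFinset_pos H y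
    rw [← h]
    exact le_mul_of_one_le_left (sum_nonneg fun F _ ↦ Nat.cast_nonneg _) hone
  have hswap : ∀ f : SimpleGraph V → V → ℝ,
      ∑ F ∈ H.forestsAbove, ∑ y, (if ¬ F.Reachable u y then f F y else 0) =
      ∑ y with ¬ H.Reachable u y, ∑ F ∈ H.forestsAbove with ¬ F.Reachable u y, f F y := by
    intro f
    rw [sum_comm, sum_filter]
    refine sum_congr rfl fun y _ ↦ ?_
    rw [sum_filter]
    by_cases h : H.Reachable u y
    · simp only [h, not_true, if_false]
      refine sum_eq_zero fun F hF ↦ ?_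
      simp [h.mono (mem_forestsAbove.1 hF).2]
    · simp [h]
  have hX₁ : ∑ F ∈ H.forestsAbove, ∑ y,
      (if ¬ F.Reachable u y then (#(F.compFinset u) : ℝ) else 0) ≤ (n - s) * M - O := by
    rw [hswap fun F _ ↦ (#(F.compFinset u) : ℝ), ← hP]
    exact sum_le_sum fun y hy ↦ hdbl' y (mem_filter.1 hy).2
  have hY : s * ∑ F ∈ H.forestsAbove, ∑ y,
      (if ¬ F.Reachable u y then (#(F.compFinset y) : ℝ) else 0) = (n - s) * M - O := by
    rw [hswap fun F y ↦ (#(F.compFinset y) : ℝ), ← hP, mul_sum]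
    exact sum_congr rfl fun y hy ↦ hdbl y (mem_filter.1 hy).2
  have hX₂ := sum_card_three_components_le H u
  have hsum : n * O = ∑ F ∈ H.forestsAbove, ∑ y,
        (if ¬ F.Reachable u y then (#(F.compFinset u) : ℝ) else 0) +
      ∑ F ∈ H.forestsAbove, ∑ y,
        (if ¬ F.Reachable u y then (#(F.compFinset y) : ℝ) else 0) +
      ∑ F ∈ H.forestsAbove, ∑ x, ∑ y,
        (if ¬ F.Reachable x y ∧ ¬ F.Reachable u x ∧ ¬ F.Reachable u y then (1 : ℝ) else 0) := by
    rw [hO, mul_sum, ← sum_add_distrib, ← sum_add_distrib]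
    refine sum_congr rfl fun F _ ↦ ?_
    rw [mul_sum, ← sum_add_distrib, ← sum_add_distrib]
    refine sum_congr rfl fun x _ ↦ ?_
    by_cases hx : F.Reachable u x
    · simp [hx]
    simp only [hx, not_false_eq_true, if_true, true_and, mul_one]
    rw [hn, ← card_univ, card_eq_sum_ones, compFinset, compFinset, card_eq_sum_ones,
      card_eq_sum_ones]
    push_cast
    rw [sum_filter, sum_filter, ← sum_add_distrib, ← sum_add_distrib]
    refine sum_congr rfl fun y _ ↦ ?_
    by_cases h₁ : F.Reachable u y
    · have h₂ : ¬ F.Reachable x y := fun h ↦ hx (h₁.trans h.symm)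
      simp [h₁, h₂]
    · by_cases h₂ : F.Reachable x y <;> simp [h₁, h₂]
  have hs₁ : (1 : ℝ) ≤ s := by
    rw [hs]
    exact_mod_cast card_compFinset_pos H u
  have hsn : s ≤ n := by
    rw [hs, hn]
    exact_mod_cast card_le_univ _
  have hM₀ : 0 ≤ M := by positivity
  have hmain : (s * n - s + 1) * O ≤ (s + 1) * ((n - s) * M) := by
    nlinarith [mul_le_mul_of_nonneg_left hX₁ (zero_le_one.trans hs₁),
      mul_le_mul_of_nonneg_left hX₂ (zero_le_one.trans hs₁)]
  have hpos : 0 < s * n - s + 1 := by nlinarith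
  refine le_of_mul_le_mul_left ?_ hpos
  have hpoly : (s - 1) * ((s + 1) * (n - s)) ≤ (s * n - s + 1) * s := by
    nlinarith [mul_nonneg (sq_nonneg s) (sub_nonneg.2 hs₁)]
  nlinarith [mul_le_mul_of_nonneg_left hmain (sub_nonneg.2 hs₁),
    mul_le_mul_of_nonneg_right hpoly hM₀]

/-- The forests containing `H` correspond to the forests containing `H \ edge u v` in which `u`
and `v` are not joined. -/
theorem sum_forestsAbove_eq_sum_sdiff_edge {H : SimpleGraph V} {u v : V} (huv : H.Adj u v)
    (f : SimpleGraph V → ℝ) :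
    ∑ F ∈ H.forestsAbove, f F =
      ∑ F ∈ (H \ edge u v).forestsAbove with ¬ F.Reachable u v, f (F ⊔ edge u v) := by
  refine sum_bij' (fun F _ ↦ F \ edge u v) (fun F _ ↦ F ⊔ edge u v) ?_ ?_ ?_ ?_ ?_
  · intro F hF
    obtain ⟨hac, hle⟩ := mem_forestsAbove.1 hF
    rw [mem_filter, mem_forestsAbove]
    exact ⟨⟨hac.anti sdiff_le, sdiff_le_sdiff_right hle⟩,
      hac.not_reachable_sdiff_edge (hle huv)⟩
  · intro F hF
    rw [mem_filter, mem_forestsAbove] at hF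
    rw [mem_forestsAbove]
    refine ⟨hF.1.1.sup_edge_of_not_reachable hF.2, ?_⟩
    rw [← sdiff_edge_sup_edge huv]
    exact sup_le_sup_right hF.1.2 _
  · intro F hF
    exact sdiff_edge_sup_edge ((mem_forestsAbove.1 hF).2 huv)
  · intro F hF
    exact sup_edge_sdiff_edge fun h ↦ (mem_filter.1 hF).2 h.reachable
  · intro F hF
    rw [sdiff_edge_sup_edge ((mem_forestsAbove.1 hF).2 huv)]

/-- Among the forests containing `H`, where `uv` is a pendant edge of `H`, the component of `u`
is related to the forests containing `H` without that edge in which `u` and `v` are joined. -/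
theorem sum_card_compFinset_of_leaf {H : SimpleGraph V} (hH : H.IsAcyclic) {u v : V}
    (huv : H.Adj u v) (hleaf : ∀ w, H.Adj v w → w = u) (φ : SimpleGraph V → ℝ)
    (hφ : ∀ F F' : SimpleGraph V, F.Reachable = F'.Reachable → φ F = φ F') :
    ((#(H.compFinset u) : ℝ) - 1) * ∑ F ∈ H.forestsAbove, #(F.compFinset u) * φ F =
      #(H.compFinset u) * ∑ F ∈ (H \ edge u v).forestsAbove with F.Reachable u v, φ F := by
  have hn : ¬ (H \ edge u v).Reachable u v := hH.not_reachable_sdiff_edge huv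
  have hn' : ¬ (H \ edge u v).Reachable v u := fun h ↦ hn h.symm
  have hv : (H \ edge u v).compFinset v = {v} := by
    ext x
    rw [mem_compFinset, mem_singleton]
    refine ⟨?_, fun h ↦ h ▸ .rfl⟩
    rintro ⟨p⟩
    cases p with
    | nil => rfl
    | cons h p =>
      rw [sdiff_adj, edge_adj] at h
      obtain rfl := hleaf _ h.1
      exact absurd ⟨Or.inr ⟨rfl, rfl⟩, h.1.ne⟩ h.2
  have hcard : (#(H.compFinset u) : ℝ) = #((H \ edge u v).compFinset u) + 1 := by
    have h := card_compFinset_sup_edge hn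
    rw [sdiff_edge_sup_edge huv, hv, card_singleton] at h
    exact_mod_cast h
  have hreindex : ∑ F ∈ H.forestsAbove, (#(F.compFinset u) : ℝ) * φ F =
      ∑ F ∈ (H \ edge u v).forestsAbove with ¬ F.Reachable u v,
        ((#(F.compFinset u) : ℝ) + #(F.compFinset v)) * φ (F ⊔ edge u v) := by
    rw [sum_forestsAbove_eq_sum_sdiff_edge huv]
    refine sum_congr rfl fun F hF ↦ ?_
    rw [card_compFinset_sup_edge (mem_filter.1 hF).2]
    push_cast
    rfl
  have h₁ := card_mul_sum_not_reachable _ hn φ hφ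
  have h₂ := card_mul_sum_not_reachable _ hn' φ hφ
  simp only [hv, card_singleton, Nat.cast_one, one_mul, reachable_comm (u := v) (v := u),
    edge_comm v u] at h₂
  rw [hreindex, hcard]
  simp only [add_mul, sum_add_distrib, add_sub_cancel_right, mul_add]
  rw [h₁, h₂]
  ring

/-- The trees on `V` that contain `H`. -/
noncomputable def treesAbove (H : SimpleGraph V) : Finset (SimpleGraph V) :=
  {F ∈ H.forestsAbove | F.Connected}

/-- Forcing a pendant edge does not decrease the probability of being connected. -/
theorem card_forestsAbove_mul_card_treesAbove_le {H : SimpleGraph V} (hH : H.IsAcyclic) {u v : V}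
    (huv : H.Adj u v) (hleaf : ∀ w, H.Adj v w → w = u) :
    #H.forestsAbove * #(H \ edge u v).treesAbove ≤
      #(H \ edge u v).forestsAbove * #H.treesAbove := by
  set H' := H \ edge u v with hH'
  have hn : ¬ H'.Reachable u v := hH.not_reachable_sdiff_edge huv
  have hout := sum_card_outside_le H u
  have hone := sum_card_compFinset_of_leaf hH huv hleaf (fun _ ↦ 1) (fun _ _ _ ↦ rfl)
  have hconn := sum_card_compFinset_of_leaf hH huv hleaf
    (fun F ↦ if F.Connected then 1 else 0) (fun F F' h ↦ by simp only [connected_congr h])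
  set s : ℝ := (#(H.compFinset u) : ℝ) with hs
  set O : ℝ := ∑ F ∈ H.forestsAbove, ∑ x, (if ¬ F.Reachable u x then (1 : ℝ) else 0) with hO
  have hs₁ : (1 : ℝ) ≤ s := by
    rw [hs]
    exact_mod_cast card_compFinset_pos H u
  have htree : ∑ F ∈ H.forestsAbove, (#(F.compFinset u) : ℝ) * (if F.Connected then 1 else 0) =
      Fintype.card V * #H.treesAbove := by
    rw [treesAbove, card_eq_sum_ones, sum_filter]
    push_cast
    rw [mul_sum]
    refine sum_congr rfl fun F _ ↦ ?_
    split_ifs with h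
    · have : F.compFinset u = univ := by
        ext x
        simp [mem_compFinset, h.preconnected u x]
      rw [this, card_univ]
    · simp
  have htree' : ∑ F ∈ H'.forestsAbove with F.Reachable u v,
      (if F.Connected then (1 : ℝ) else 0) = #H'.treesAbove := by
    rw [treesAbove, card_eq_sum_ones, sum_filter, sum_filter]
    push_cast
    refine sum_congr rfl fun F _ ↦ ?_
    by_cases h : F.Connected
    · simp [h, h.preconnected u v]
    · simp [h]
  have hforest : ∑ F ∈ H.forestsAbove, (#(F.compFinset u) : ℝ) * 1 =
      Fintype.card V * #H.forestsAbove - O := by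
    rw [hO, eq_sub_iff_add_eq, ← sum_add_distrib, mul_comm, ← nsmul_eq_mul, ← sum_const]
    refine sum_congr rfl fun F _ ↦ ?_
    rw [mul_one, ← card_univ, ← sum_filter, sum_const, nsmul_eq_mul, mul_one, compFinset]
    exact_mod_cast card_filter_add_card_filter_not (s := univ) (fun x ↦ F.Reachable u x)
  have hforest' : ∑ F ∈ H'.forestsAbove with F.Reachable u v, (1 : ℝ) =
      #H'.forestsAbove - #H.forestsAbove := by
    have hcard := sum_forestsAbove_eq_sum_sdiff_edge huv (fun _ ↦ 1)
    rw [sum_const, nsmul_eq_mul, mul_one] at hcard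
    rw [eq_sub_iff_add_eq, hcard, sum_filter_add_sum_filter_not, sum_const, nsmul_eq_mul, mul_one]
  rw [htree, htree'] at hconn
  rw [hforest, hforest'] at hone
  have hC₀ : (0 : ℝ) ≤ #H.treesAbove := Nat.cast_nonneg _
  have hkey : (#H.forestsAbove : ℝ) * #H'.treesAbove ≤ #H'.forestsAbove * #H.treesAbove := by
    refine le_of_mul_le_mul_left ?_ (zero_lt_one.trans_le hs₁)
    have h₁ : (s - 1) * (Fintype.card V * #H.forestsAbove) ≤ s * #H'.forestsAbove := by linarith
    calc
      s * ((#H.forestsAbove : ℝ) * #H'.treesAbove)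
        = (s - 1) * (Fintype.card V * #H.forestsAbove) * #H.treesAbove := by
          linear_combination -(#H.forestsAbove : ℝ) * hconn
      _ ≤ s * #H'.forestsAbove * #H.treesAbove := mul_le_mul_of_nonneg_right h₁ hC₀
      _ = _ := by ring
  exact_mod_cast hkey

theorem IsAcyclic.exists_leaf {H : SimpleGraph V} (hH : H.IsAcyclic) (hne : H ≠ ⊥) :
    ∃ u v, H.Adj u v ∧ ∀ w, H.Adj v w → w = u := by
  obtain ⟨a, b, hab⟩ := ne_bot_iff_exists_adj.1 hne
  have : Nonempty V := ⟨a⟩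
  obtain ⟨v, t, p, hp, hmax⟩ := Walk.exists_isPath_forall_isPath_length_le_length H
  have hlen := hmax _ _ hab.toWalk (by simp [hab.ne])
  have hnil : ¬ p.Nil := fun h ↦ by
    rw [Walk.length_eq_zero_iff.2 h] at hlen
    simp at hlen
  refine ⟨p.snd, v, (p.adj_snd hnil).symm, fun w hw ↦ hH.eq_snd_of_adj_start hp hw ?_⟩
  by_contra hw'
  have := hmax _ _ (p.cons hw.symm) (hp.cons hw')
  simp at this

/-- A random forest is at least as likely to be connected when it is conditioned to contain a
given forest. -/
theorem card_forestsAbove_mul_card_treesAbove_bot_le {H : SimpleGraph V} (hH : H.IsAcyclic) :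
    #H.forestsAbove * #(⊥ : SimpleGraph V).treesAbove ≤
      #(⊥ : SimpleGraph V).forestsAbove * #H.treesAbove := by
  induction H using WellFoundedLT.induction with
  | ind H ih =>
    by_cases hne : H = ⊥
    · rw [hne]
    obtain ⟨u, v, huv, hleaf⟩ := hH.exists_leaf hne
    have hlt : H \ edge u v < H := by
      refine sdiff_le.lt_of_ne fun h ↦ hH.not_reachable_sdiff_edge huv ?_
      rw [h]
      exact huv.reachable
    have hac : (H \ edge u v).IsAcyclic := hH.anti sdiff_le
    have h₁ := ih _ hlt hac
    have h₂ := card_forestsAbove_mul_card_treesAbove_le hH huv hleaf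
    have hpos : 0 < #(H \ edge u v).forestsAbove :=
      card_pos.2 ⟨_, mem_forestsAbove.2 ⟨hac, le_rfl⟩⟩
    refine Nat.le_of_mul_le_mul_left ?_ hpos
    calc
      _ = #H.forestsAbove * (#(H \ edge u v).forestsAbove * #(⊥ : SimpleGraph V).treesAbove) := by
        ring
      _ ≤ #H.forestsAbove * (#(⊥ : SimpleGraph V).forestsAbove * #(H \ edge u v).treesAbove) :=
        Nat.mul_le_mul_left _ h₁
      _ = #(⊥ : SimpleGraph V).forestsAbove * (#H.forestsAbove * #(H \ edge u v).treesAbove) := by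
        ring
      _ ≤ #(⊥ : SimpleGraph V).forestsAbove * (#(H \ edge u v).forestsAbove * #H.treesAbove) :=
        Nat.mul_le_mul_left _ h₂
      _ = _ := by ring

/-- The graphs with a given bridgeless core correspond, with the same components, to the forests
containing a spanning forest `H` of the core. -/
theorem card_filter_bridgelessCore_eq {G H : SimpleGraph V} (hH : H.IsAcyclic)
    (hr : H.Reachable = G.bridgelessCore.Reachable) (P : SimpleGraph V → Prop)
    (hP : ∀ F F' : SimpleGraph V, F.Reachable = F'.Reachable → (P F ↔ P F')) :
    #{G' | G'.bridgelessCore = G.bridgelessCore ∧ P G'} = #{F ∈ H.forestsAbove | P F} := by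
  set B := G.bridgelessCore
  simp only [B, bridgelessCore_eq_bridgelessCore_iff]
  have hinv : ∀ {K L K' : SimpleGraph V}, K.IsBridgeExtension L → K'.Reachable = K.Reachable →
      K ⊔ (K' ⊔ L \ K) \ K' = L := fun h hr ↦ by
    rw [h.sup_sdiff_sdiff hr, sup_sdiff_cancel_right h.1]
  refine card_bij' (fun G' _ ↦ H ⊔ G' \ B) (fun F _ ↦ B ⊔ F \ H) ?_ ?_ ?_ ?_
  · intro G' hG'
    obtain ⟨-, hext, hPG⟩ := mem_filter.1 hG'
    exact mem_filter.2 ⟨mem_forestsAbove.2 ⟨(hext.sup_sdiff hr).isAcyclic hH, le_sup_left⟩,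
      (hP _ _ (hext.reachable_sup_sdiff hr)).2 hPG⟩
  · intro F hF
    obtain ⟨hF, hPF⟩ := mem_filter.1 hF
    have hext := (mem_forestsAbove.1 hF).1.isBridgeExtension (mem_forestsAbove.1 hF).2
    exact mem_filter.2 ⟨mem_univ _, hext.sup_sdiff hr.symm,
      (hP _ _ (hext.reachable_sup_sdiff hr.symm)).2 hPF⟩
  · intro G' hG'
    exact hinv (mem_filter.1 hG').2.1 hr
  · intro F hF
    have hF := mem_forestsAbove.1 (mem_filter.1 hF).1
    exact hinv (hF.1.isBridgeExtension hF.2) hr.symm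

theorem card_filter_bridgelessCore_mul_le (G : SimpleGraph V) :
    #{G' : SimpleGraph V | G'.bridgelessCore = G.bridgelessCore} * #(⊥ : SimpleGraph V).treesAbove ≤
      #(⊥ : SimpleGraph V).forestsAbove *
        #{G' : SimpleGraph V | G'.bridgelessCore = G.bridgelessCore ∧ G'.Connected} := by
  obtain ⟨H, -, hH, hr⟩ := G.bridgelessCore.exists_isAcyclic_reachable_eq_le
  have h₁ := card_filter_bridgelessCore_eq hH hr (fun _ ↦ True) (fun _ _ _ ↦ Iff.rfl)
  have h₂ : #{G' : SimpleGraph V | G'.bridgelessCore = G.bridgelessCore ∧ G'.Connected} =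
      #H.treesAbove := by
    rw [treesAbove]
    convert card_filter_bridgelessCore_eq hH hr (fun F ↦ F.Connected) fun _ _ h ↦ connected_congr h
  simp only [and_true, filter_true] at h₁
  rw [h₁, h₂]
  exact card_forestsAbove_mul_card_treesAbove_bot_le hH

/-- If membership in `A` depends only on the bridgeless core, then a random graph from `A` is at
least as likely to be connected as a random forest. -/
theorem card_mul_card_treesAbove_bot_le (A : Finset (SimpleGraph V))
    (hA : ∀ G, G ∈ A ↔ G.bridgelessCore ∈ A) :
    #A * #(⊥ : SimpleGraph V).treesAbove ≤
      #(⊥ : SimpleGraph V).forestsAbove * #{G ∈ A | G.Connected} := by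
  have hmaps : Set.MapsTo bridgelessCore (A : Set (SimpleGraph V))
      (A.image bridgelessCore : Finset (SimpleGraph V)) :=
    fun G hG ↦ mem_coe.2 (mem_image_of_mem _ hG)
  have hsub : {G ∈ A | G.Connected} ⊆ A := filter_subset _ _
  rw [card_eq_sum_card_fiberwise hmaps, card_eq_sum_card_fiberwise (hmaps.mono_left hsub),
    sum_mul, mul_sum]
  refine sum_le_sum fun B hB ↦ ?_
  obtain ⟨G, hG, rfl⟩ := mem_image.1 hB
  have hmem : ∀ G', G'.bridgelessCore = G.bridgelessCore → G' ∈ A := fun G' h ↦ by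
    rw [hA, h, ← hA]
    exact hG
  refine (Nat.mul_le_mul_right _ (card_le_card fun G' h ↦ ?_)).trans
    ((card_filter_bridgelessCore_mul_le G).trans
      (Nat.mul_le_mul_left _ (card_le_card fun G' h ↦ ?_)))
  · exact mem_filter.2 ⟨mem_univ _, (mem_filter.1 h).2⟩
  · obtain ⟨-, hcore, hconn⟩ := mem_filter.1 h
    exact mem_filter.2 ⟨mem_filter.2 ⟨hmem _ hcore, hconn⟩, hcore⟩

end Counting

end SimpleGraph

open SimpleGraph

theorem BridgeAlterable.mem_iff_deleteEdges_mem {n : ℕ} {A : Set (SimpleGraph (Fin n))}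
    (hA : BridgeAlterable A) (G : SimpleGraph (Fin n)) {S : Set (Sym2 (Fin n))}
    (hS : ∀ e ∈ S, G.IsBridge e) : G ∈ A ↔ G.deleteEdges S ∈ A := by
  induction S, S.toFinite using Set.Finite.induction_on with
  | empty => rw [deleteEdges_empty]
  | @insert e S _ _ ih =>
    rw [ih fun f hf ↦ hS f (Set.mem_insert_of_mem _ hf), Set.insert_eq, Set.union_comm,
      ← deleteEdges_deleteEdges]
    exact hA _ _ (IsBridge.anti (deleteEdges_le _) (hS e (Set.mem_insert _ _)))

theorem forestCount_eq_card_forestsAbove (n : ℕ) :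
    forestCount n = (⊥ : SimpleGraph (Fin n)).forestsAbove.card := by
  rw [forestCount, ← Set.ncard_coe_finset]
  congr 1
  ext F
  simp [mem_forestsAbove]

theorem treeCount_eq_card_treesAbove (n : ℕ) :
    treeCount n = (⊥ : SimpleGraph (Fin n)).treesAbove.card := by
  rw [treeCount, ← Set.ncard_coe_finset]
  congr 1
  ext F
  simp [treesAbove, mem_forestsAbove, isTree_iff, and_comm]

/-- A random graph from a bridge-alterable set is at least as likely to be connected as a random
forest on the same vertices. -/
theorem BridgeAlterable.ncard_mul_treeCount_le {n : ℕ} {A : Set (SimpleGraph (Fin n))}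
    (hA : BridgeAlterable A) :
    A.ncard * treeCount n ≤ forestCount n * {G ∈ A | G.Connected}.ncard := by
  classical
  have hcore : ∀ G, G ∈ A.toFinset ↔ G.bridgelessCore ∈ A.toFinset := fun G ↦ by
    rw [Set.mem_toFinset, Set.mem_toFinset]
    exact hA.mem_iff_deleteEdges_mem G fun _ h ↦ h
  have hconn : {G ∈ A | G.Connected} = ({G ∈ A.toFinset | G.Connected} : Finset _) := by
    ext G
    simp
  rw [forestCount_eq_card_forestsAbove, treeCount_eq_card_treesAbove, hconn,
    Set.ncard_coe_finset, Set.ncard_eq_toFinset_card']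
  convert card_mul_card_treesAbove_bot_le A.toFinset hcore

theorem connected_prob_ge_min_forest_prob (n : ℕ) (hn : 1 ≤ n)
    (A : Set (SimpleGraph (Fin n))) (hA : A.Nonempty) (halt : BridgeAlterable A) :
    sInf {r : ℝ | ∃ t : ℕ, (n : ℝ) / 3 < t ∧ t ≤ n ∧
        r = (treeCount t : ℝ) / (forestCount t : ℝ)}
      ≤ ({G ∈ A | G.Connected}.ncard : ℝ) / (A.ncard : ℝ) := by
  have hn₀ : (0 : ℝ) < n := by exact_mod_cast hn
  have hbdd : BddBelow {r : ℝ | ∃ t : ℕ, (n : ℝ) / 3 < t ∧ t ≤ n ∧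
      r = (treeCount t : ℝ) / (forestCount t : ℝ)} := by
    refine ⟨0, ?_⟩
    rintro _ ⟨t, -, -, rfl⟩
    positivity
  have hF : (0 : ℝ) < forestCount n := by
    rw [forestCount_eq_card_forestsAbove]
    exact_mod_cast Finset.card_pos.2 ⟨⊥, mem_forestsAbove.2 ⟨isAcyclic_bot, le_rfl⟩⟩
  have hA₀ : (0 : ℝ) < A.ncard := by exact_mod_cast (Set.ncard_pos A.toFinite).2 hA
  refine (csInf_le hbdd ⟨n, by linarith, le_rfl, rfl⟩).trans ?_
  rw [div_le_div_iff₀ hF hA₀, mul_comm, mul_comm _ (forestCount n : ℝ)]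
  exact_mod_cast halt.ncard_mul_treeCount_le
end

section
/- For every ε > 0 there exists N such that for every integer n ≥ N and every nonempty bridge-alterable set 𝒜ₙ of simple graphs on vertex set {1,…,n}, the proportion of connected graphs in 𝒜ₙ satisfies |{G ∈ 𝒜ₙ : G is connected}| / |𝒜ₙ| ≥ e^{-1/2 - ε}. -/
namespace BridgeExtension

open Finset
open scoped Classical

section

variable {V : Type*}

/-- `G` is obtained from `G₀` by adding edges, each of which is a bridge of `G`. -/
structure IsBridgeExt (G₀ G : SimpleGraph V) : Prop where
  le : G₀ ≤ G
  isBridge : ∀ x y, G.Adj x y → ¬ G₀.Adj x y → G.IsBridge s(x, y)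

/-- `x` and `y` are adjacent in `G` but not in `G₀`. -/
def NewAdj (G₀ G : SimpleGraph V) (x y : V) : Prop := G.Adj x y ∧ ¬ G₀.Adj x y

theorem NewAdj.symm {G₀ G : SimpleGraph V} {x y : V} (h : NewAdj G₀ G x y) : NewAdj G₀ G y x :=
  ⟨h.1.symm, fun h' => h.2 h'.symm⟩

theorem reachable_sup_edge_iff (H : SimpleGraph V) (x y u v : V) :
    (H ⊔ SimpleGraph.edge x y).Reachable u v ↔ H.Reachable u v ∨
      (H.Reachable u x ∧ H.Reachable y v) ∨ (H.Reachable u y ∧ H.Reachable x v) := by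
  have hle : H ≤ H ⊔ SimpleGraph.edge x y := le_sup_left
  constructor
  · rintro ⟨p⟩
    induction p with
    | nil => exact Or.inl (SimpleGraph.Reachable.refl _)
    | cons h p ih =>
      rename_i a b c
      rw [SimpleGraph.sup_adj, SimpleGraph.edge_adj] at h
      rcases h with h | ⟨⟨rfl, rfl⟩ | ⟨rfl, rfl⟩, -⟩
      · have := h.reachable
        rcases ih with ih | ⟨i, j⟩ | ⟨i, j⟩
        · exact Or.inl (this.trans ih)
        · exact Or.inr (Or.inl ⟨this.trans i, j⟩)
        · exact Or.inr (Or.inr ⟨this.trans i, j⟩)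
      · rcases ih with ih | ⟨i, j⟩ | ⟨i, j⟩
        · exact Or.inr (Or.inl ⟨.refl _, ih⟩)
        · exact Or.inr (Or.inl ⟨.refl _, j⟩)
        · exact Or.inl j
      · rcases ih with ih | ⟨i, j⟩ | ⟨i, j⟩
        · exact Or.inr (Or.inr ⟨.refl _, ih⟩)
        · exact Or.inl j
        · exact Or.inr (Or.inr ⟨.refl _, j⟩)
  · have hxy : (H ⊔ SimpleGraph.edge x y).Reachable x y := by
      by_cases h : x = y
      · subst h; exact .refl _
      · exact SimpleGraph.Adj.reachable (Or.inr (by simp [SimpleGraph.edge_adj, h]))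
    rintro (h | ⟨h, h'⟩ | ⟨h, h'⟩)
    · exact h.mono hle
    · exact (h.mono hle).trans (hxy.trans (h'.mono hle))
    · exact (h.mono hle).trans (hxy.symm.trans (h'.mono hle))

theorem deleteEdges_sup_edge {G : SimpleGraph V} {x y : V} (h : G.Adj x y) :
    G.deleteEdges {s(x, y)} ⊔ SimpleGraph.edge x y = G := by
  ext u v
  have := h.symm
  simp only [SimpleGraph.sup_adj, SimpleGraph.deleteEdges_adj, SimpleGraph.edge_adj,
    Set.mem_singleton_iff, Sym2.eq_iff]
  constructor
  · rintro (h | ⟨⟨rfl, rfl⟩ | ⟨rfl, rfl⟩, -⟩) <;> simp_all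
  · intro h'
    have := h'.ne
    tauto

theorem sup_edge_deleteEdges {H : SimpleGraph V} {x y : V} (h : ¬ H.Adj x y) :
    (H ⊔ SimpleGraph.edge x y).deleteEdges {s(x, y)} = H := by
  ext u v
  have h' : ¬ H.Adj y x := fun h' => h h'.symm
  simp only [SimpleGraph.sup_adj, SimpleGraph.deleteEdges_adj, SimpleGraph.edge_adj,
    Set.mem_singleton_iff, Sym2.eq_iff]
  constructor
  · tauto
  · intro h''
    refine ⟨Or.inl h'', ?_⟩
    rintro (⟨rfl, rfl⟩ | ⟨rfl, rfl⟩) <;> contradiction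

theorem IsBridgeExt.sup_edge {G₀ H : SimpleGraph V} (hH : IsBridgeExt G₀ H) {x y : V}
    (h : ¬ H.Reachable x y) : IsBridgeExt G₀ (H ⊔ SimpleGraph.edge x y) := by
  refine ⟨hH.le.trans le_sup_left, fun u v huv h0 => ?_⟩
  by_cases hadj : H.Adj u v
  · exact SimpleGraph.IsBridge.sup_edge_of_not_reachable_of_isBridge h
      (hH.isBridge u v hadj h0) hadj
  · have : s(u, v) = s(x, y) := by
      rcases huv with huv | huv
      · exact absurd huv hadj
      · exact ((SimpleGraph.adj_edge _ _).1 huv).1.symm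
    rw [this, SimpleGraph.isBridge_sup_edge]
    exact .of_not_reachable h

theorem newAdj_sup_edge {G₀ H : SimpleGraph V} (hH : IsBridgeExt G₀ H) {x y : V}
    (h : ¬ H.Reachable x y) : NewAdj G₀ (H ⊔ SimpleGraph.edge x y) x y := by
  refine ⟨Or.inr ?_, fun h0 => h (hH.le h0).reachable⟩
  have : x ≠ y := by rintro rfl; exact h (.refl _)
  simp [SimpleGraph.edge_adj, this]

theorem IsBridgeExt.deleteEdges {G₀ G : SimpleGraph V} (hG : IsBridgeExt G₀ G) {x y : V}
    (h : NewAdj G₀ G x y) : IsBridgeExt G₀ (G.deleteEdges {s(x, y)}) := by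
  refine ⟨fun u v huv => ?_, fun u v huv h0 => ?_⟩
  · rw [SimpleGraph.deleteEdges_adj]
    refine ⟨hG.le huv, fun he => h.2 ?_⟩
    rw [Set.mem_singleton_iff, Sym2.eq_iff] at he
    rcases he with ⟨rfl, rfl⟩ | ⟨rfl, rfl⟩
    · exact huv
    · exact huv.symm
  · exact (hG.isBridge u v (SimpleGraph.deleteEdges_le _ huv) h0).anti
      (SimpleGraph.deleteEdges_le _)

theorem IsBridgeExt.not_reachable {G₀ G : SimpleGraph V} (hG : IsBridgeExt G₀ G) {x y : V}
    (h : NewAdj G₀ G x y) : ¬ (G.deleteEdges {s(x, y)}).Reachable x y :=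
  SimpleGraph.isBridge_iff.1 (hG.isBridge x y h.1 h.2)

/-- The relation between reachability in `G` and in `G` minus a new edge. -/
theorem reachable_iff_deleteEdges {G : SimpleGraph V} {x y : V} (h : G.Adj x y) (u v : V) :
    G.Reachable u v ↔ (G.deleteEdges {s(x, y)}).Reachable u v ∨
      ((G.deleteEdges {s(x, y)}).Reachable u x ∧ (G.deleteEdges {s(x, y)}).Reachable y v) ∨
      ((G.deleteEdges {s(x, y)}).Reachable u y ∧ (G.deleteEdges {s(x, y)}).Reachable x v) := by
  conv_lhs => rw [← deleteEdges_sup_edge h]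
  exact reachable_sup_edge_iff _ _ _ _ _

/-- A walk entering `S` from outside contains an edge crossing into `S` whose tail is still
reachable after that edge is removed. -/
theorem exists_entering_edge {G : SimpleGraph V} (S : Set V) {u v : V} (p : G.Walk u v)
    (hu : u ∉ S) (hv : v ∈ S) :
    ∃ x y, G.Adj x y ∧ x ∉ S ∧ y ∈ S ∧ (G.deleteEdges {s(x, y)}).Reachable u x := by
  induction p with
  | nil => exact absurd hv hu
  | cons h p ih =>
    rename_i a b c
    by_cases hb : b ∈ S
    · exact ⟨a, b, h, hu, hb, .refl _⟩
    · obtain ⟨x, y, hxy, hx, hy, hr⟩ := ih hb hv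
      refine ⟨x, y, hxy, hx, hy, SimpleGraph.Reachable.trans (SimpleGraph.Adj.reachable ?_) hr⟩
      rw [SimpleGraph.deleteEdges_adj]
      refine ⟨h, fun he => ?_⟩
      rw [Set.mem_singleton_iff, Sym2.eq_iff] at he
      rcases he with ⟨rfl, rfl⟩ | ⟨rfl, rfl⟩ <;> contradiction

theorem IsBridgeExt.le_deleteEdges {G₀ G : SimpleGraph V} (hG : IsBridgeExt G₀ G) {x y : V}
    (h : NewAdj G₀ G x y) : G₀ ≤ G.deleteEdges {s(x, y)} := (hG.deleteEdges h).le

theorem IsBridgeExt.existsUnique_entering_edge {G₀ G : SimpleGraph V} (hG : IsBridgeExt G₀ G)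
    {r v : V} (hr : G.Reachable r v) (h0 : ¬ G₀.Reachable r v) :
    ∃! e : V × V, NewAdj G₀ G e.1 e.2 ∧ (G.deleteEdges {s(e.1, e.2)}).Reachable r e.1 ∧
      G₀.Reachable e.2 v := by
  obtain ⟨p⟩ := hr
  obtain ⟨x, y, hxy, hx, hy, hrx⟩ := exists_entering_edge {z | G₀.Reachable z v} p h0 (.refl _)
  refine ⟨(x, y), ⟨⟨hxy, fun h => hx (h.reachable.trans hy)⟩, hrx, hy⟩, ?_⟩
  rintro ⟨x', y'⟩ ⟨hn', hr', hy'⟩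
  have hn : NewAdj G₀ G x y := ⟨hxy, fun h => hx (h.reachable.trans hy)⟩
  simp only [Set.mem_ofPred_eq] at hx hy hn' hr' hy' ⊢
  have hyy : G₀.Reachable y y' := hy.trans hy'.symm
  -- `r` reaches neither head once the corresponding edge is removed
  have key : ¬ (G.deleteEdges {s(x, y)}).Reachable r y := fun h =>
    hG.not_reachable hn (hrx.symm.trans h)
  have key' : ¬ (G.deleteEdges {s(x', y')}).Reachable r y' := fun h =>
    hG.not_reachable hn' (hr'.symm.trans h)
  have key'' : ¬ (G.deleteEdges {s(x', y')}).Reachable r y := fun h =>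
    key' (h.trans (hyy.mono (hG.le_deleteEdges hn')))
  by_contra hne
  have hedge : s(x', y') ≠ s(x, y) := by
    intro he
    rw [Sym2.eq_iff] at he
    rcases he with ⟨rfl, rfl⟩ | ⟨rfl, rfl⟩
    · exact hne rfl
    · exact hx hy'
  have hrx' : (G.deleteEdges {s(x, y)}).Reachable r x' := by
    obtain ⟨q⟩ := hr'
    clear hrx key
    have : ∀ {a b : V} (q : (G.deleteEdges {s(x', y')}).Walk a b),
        ¬ (G.deleteEdges {s(x', y')}).Reachable a y → (G.deleteEdges {s(x, y)}).Reachable a b := by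
      intro a b q
      induction q with
      | nil => intro _; exact .refl _
      | cons h q ih =>
        rename_i a b c
        intro ha
        have hb : ¬ (G.deleteEdges {s(x', y')}).Reachable b y := fun h' => ha (h.reachable.trans h')
        refine SimpleGraph.Reachable.trans (SimpleGraph.Adj.reachable ?_) (ih hb)
        rw [SimpleGraph.deleteEdges_adj]
        refine ⟨SimpleGraph.deleteEdges_le _ h, fun he => ?_⟩
        rw [Set.mem_singleton_iff, Sym2.eq_iff] at he
        rcases he with ⟨rfl, rfl⟩ | ⟨rfl, rfl⟩
        · exact hb (.refl _)
        · exact ha (.refl _)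
    exact this q key''
  have hadj : (G.deleteEdges {s(x, y)}).Adj x' y' := by
    rw [SimpleGraph.deleteEdges_adj]
    exact ⟨hn'.1, by simpa using hedge⟩
  exact key (hrx'.trans (hadj.reachable.trans (hyy.symm.mono (hG.le_deleteEdges hn))))

end

section

variable {V : Type*} [Fintype V]

/-- The sum of `f` over the connected component of `x`. -/
noncomputable def compSum (G : SimpleGraph V) (f : V → ℝ) (x : V) : ℝ :=
  ∑ v, if G.Reachable x v then f v else 0

/-- The number of vertices in the connected component of `x`. -/
noncomputable def compSize (G : SimpleGraph V) (x : V) : ℝ := compSum G (fun _ => 1) x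

/-- The number of connected components of `G₀` inside the connected component of `x` in `G`,
provided `G₀ ≤ G`. -/
noncomputable def blobs (G₀ G : SimpleGraph V) (x : V) : ℝ :=
  compSum G (fun v => 1 / compSize G₀ v) x

theorem compSum_congr {G : SimpleGraph V} {x y : V} (h : G.Reachable x y) (f : V → ℝ) :
    compSum G f x = compSum G f y := by
  unfold compSum
  refine sum_congr rfl fun v _ => ?_
  have : G.Reachable x v ↔ G.Reachable y v := ⟨h.symm.trans, h.trans⟩
  simp only [this]

theorem compSize_congr {G : SimpleGraph V} {x y : V} (h : G.Reachable x y) :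
    compSize G x = compSize G y := compSum_congr h _

theorem blobs_congr {G₀ G : SimpleGraph V} {x y : V} (h : G.Reachable x y) :
    blobs G₀ G x = blobs G₀ G y := compSum_congr h _

theorem le_compSum {G : SimpleGraph V} {f : V → ℝ} (hf : ∀ v, 0 ≤ f v) (x : V) :
    f x ≤ compSum G f x := by
  unfold compSum
  refine le_trans ?_ (single_le_sum (f := fun v => if G.Reachable x v then f v else 0)
    (fun v _ => ?_) (mem_univ x))
  · simp
  · split_ifs
    exacts [hf v, le_rfl]

theorem compSum_mono {G : SimpleGraph V} {f g : V → ℝ} (h : ∀ v, f v ≤ g v) (x : V) :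
    compSum G f x ≤ compSum G g x := by
  unfold compSum
  refine sum_le_sum fun v _ => ?_
  split_ifs
  exacts [h v, le_rfl]

theorem one_le_compSize (G : SimpleGraph V) (x : V) : 1 ≤ compSize G x :=
  le_compSum (f := fun _ => 1) (fun _ => zero_le_one) x

theorem compSize_pos (G : SimpleGraph V) (x : V) : 0 < compSize G x :=
  zero_lt_one.trans_le (one_le_compSize G x)

theorem inv_compSize_le_one (G : SimpleGraph V) (x : V) : 1 / compSize G x ≤ 1 :=
  (div_le_one (compSize_pos G x)).2 (one_le_compSize G x)

theorem blobs_le_compSize (G₀ G : SimpleGraph V) (x : V) : blobs G₀ G x ≤ compSize G x :=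
  compSum_mono (fun v => inv_compSize_le_one G₀ v) x

theorem compSum_invariant {G : SimpleGraph V} {b : V → ℝ}
    (hb : ∀ x y, G.Reachable x y → b x = b y) (x : V) :
    compSum G b x = compSize G x * b x := by
  unfold compSize compSum
  rw [sum_mul]
  refine sum_congr rfl fun v _ => ?_
  split_ifs with h
  · rw [hb x v h, one_mul]
  · rw [zero_mul]

theorem compSum_inv_compSize (G : SimpleGraph V) (x : V) :
    compSum G (fun v => 1 / compSize G v) x = 1 := by
  rw [compSum_invariant fun x y h => by rw [compSize_congr h]]
  exact mul_one_div_cancel (compSize_pos G x).ne'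

theorem sum_mul_compSum (G : SimpleGraph V) (a b : V → ℝ) :
    ∑ x, compSum G a x * b x = ∑ x, a x * compSum G b x := by
  unfold compSum
  simp_rw [sum_mul, mul_sum]
  rw [sum_comm]
  refine sum_congr rfl fun x _ => sum_congr rfl fun y _ => ?_
  by_cases h : G.Reachable x y
  · simp [h, h.symm]
  · have h' : ¬ G.Reachable y x := fun h' => h h'.symm
    simp [h, h']

/-- Averaging `a` over components does not change its pairing with a function that is constant
on components. -/
theorem sum_compSum_div_mul {G : SimpleGraph V} {b : V → ℝ}
    (hb : ∀ x y, G.Reachable x y → b x = b y) (a : V → ℝ) :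
    ∑ x, compSum G a x / compSize G x * b x = ∑ x, a x * b x := by
  have := sum_mul_compSum G a fun x => b x / compSize G x
  calc _ = ∑ x, compSum G a x * (b x / compSize G x) := sum_congr rfl fun x _ => by ring
    _ = _ := by
      rw [this]
      refine sum_congr rfl fun x _ => ?_
      rw [compSum_invariant fun x y h => by rw [compSize_congr h, hb x y h],
        mul_div_cancel₀ _ (compSize_pos G x).ne']

theorem sum_inv_compSize (G : SimpleGraph V) :
    ∑ x, 1 / compSize G x = Nat.card G.ConnectedComponent := by
  rw [← sum_fiberwise univ G.connectedComponentMk, Nat.card_eq_fintype_card,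
    ← Finset.card_univ, card_eq_sum_ones, Nat.cast_sum]
  refine sum_congr rfl fun c _ => ?_
  induction c using SimpleGraph.ConnectedComponent.ind with
  | h x =>
    refine Eq.trans ?_ ((compSum_inv_compSize G x).trans Nat.cast_one.symm)
    rw [compSum, sum_filter]
    refine sum_congr rfl fun v _ => ?_
    simp only [SimpleGraph.ConnectedComponent.eq, SimpleGraph.reachable_comm]

section SupEdge

variable {H : SimpleGraph V} {x y : V}

theorem compSum_sup_edge_left (h : ¬ H.Reachable x y) (f : V → ℝ) :
    compSum (H ⊔ SimpleGraph.edge x y) f x = compSum H f x + compSum H f y := by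
  unfold compSum
  rw [← sum_add_distrib]
  refine sum_congr rfl fun v _ => ?_
  have h1 : (H ⊔ SimpleGraph.edge x y).Reachable x v ↔ H.Reachable x v ∨ H.Reachable y v := by
    rw [reachable_sup_edge_iff]
    have := SimpleGraph.Reachable.refl (G := H) x
    tauto
  have h2 : ¬ (H.Reachable x v ∧ H.Reachable y v) := fun h' => h (h'.1.trans h'.2.symm)
  by_cases h3 : H.Reachable x v <;> by_cases h4 : H.Reachable y v <;> simp_all

theorem compSum_sup_edge_of_not_reachable {z : V} (hx : ¬ H.Reachable x z)
    (hy : ¬ H.Reachable y z) (f : V → ℝ) :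
    compSum (H ⊔ SimpleGraph.edge x y) f z = compSum H f z := by
  unfold compSum
  refine sum_congr rfl fun v _ => ?_
  have h1 : (H ⊔ SimpleGraph.edge x y).Reachable z v ↔ H.Reachable z v := by
    rw [reachable_sup_edge_iff, H.reachable_comm (u := z) (v := x),
      H.reachable_comm (u := z) (v := y)]
    tauto
  simp only [h1]

theorem card_connectedComponent_sup_edge (h : ¬ H.Reachable x y) :
    Nat.card H.ConnectedComponent =
      Nat.card (H ⊔ SimpleGraph.edge x y).ConnectedComponent + 1 := by
  set G := H ⊔ SimpleGraph.edge x y with hG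
  have hle : H ≤ G := le_sup_left
  have hxy : G.Reachable x y := by
    rw [hG, reachable_sup_edge_iff]
    exact Or.inr (Or.inl ⟨.refl _, .refl _⟩)
  have hN : compSize G x = compSize H x + compSize H y := compSum_sup_edge_left h _
  have hx := compSize_pos H x
  have hy := compSize_pos H y
  have key : ∀ v, 1 / compSize H v = 1 / compSize G v +
      ((if H.Reachable x v then (1 : ℝ) else 0) * (1 / compSize H x - 1 / compSize G x) +
        (if H.Reachable y v then (1 : ℝ) else 0) * (1 / compSize H y - 1 / compSize G x)) := by
    intro v
    by_cases hxv : H.Reachable x v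
    · have hyv : ¬ H.Reachable y v := fun h' => h (hxv.trans h'.symm)
      rw [if_pos hxv, if_neg hyv, compSize_congr hxv, compSize_congr (hxv.mono hle)]
      ring
    · by_cases hyv : H.Reachable y v
      · rw [if_neg hxv, if_pos hyv, compSize_congr hyv, compSize_congr hxy,
          compSize_congr (hyv.mono hle)]
        ring
      · have : compSize G v = compSize H v := compSum_sup_edge_of_not_reachable hxv hyv _
        rw [if_neg hxv, if_neg hyv, this]
        ring
  have h1 := sum_inv_compSize H
  rw [sum_congr rfl fun v _ => key v, sum_add_distrib, sum_inv_compSize G, sum_add_distrib,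
    ← sum_mul, ← sum_mul] at h1
  change _ + (compSize H x * _ + compSize H y * _) = _ at h1
  have h2 : compSize H x * (1 / compSize H x - 1 / compSize G x) +
      compSize H y * (1 / compSize H y - 1 / compSize G x) = 1 := by
    rw [hN]
    field_simp
    ring
  rw [h2] at h1
  exact_mod_cast h1.symm

end SupEdge

variable {G₀ : SimpleGraph V}

theorem IsBridgeExt.one_le_blobs {G : SimpleGraph V} (hG : IsBridgeExt G₀ G) (x : V) :
    1 ≤ blobs G₀ G x := by
  rw [← compSum_inv_compSize G₀ x]
  unfold blobs compSum
  refine sum_le_sum fun v _ => ?_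
  have := (one_div_pos.2 (compSize_pos G₀ v)).le
  by_cases h : G₀.Reachable x v
  · rw [if_pos h, if_pos (h.mono hG.le)]
  · rw [if_neg h]
    split_ifs
    exacts [this, le_rfl]

/-- In the tree formed by the components of `G₀` inside a component of `G`, rooted at `r`, every
component of `G₀` other than the root has exactly one new edge towards the root. -/
theorem IsBridgeExt.sum_entering {G : SimpleGraph V} (hG : IsBridgeExt G₀ G) (r : V) :
    ∑ x, ∑ y, (if NewAdj G₀ G x y then
      (if (G.deleteEdges {s(x, y)}).Reachable r x then (1 : ℝ) else 0) else 0) =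
        blobs G₀ G r - 1 := by
  have h1 : blobs G₀ G r - 1 =
      ∑ v, if G.Reachable r v ∧ ¬ G₀.Reachable r v then 1 / compSize G₀ v else 0 := by
    have h1 := compSum_inv_compSize G₀ r
    unfold compSum at h1
    nth_rw 1 [← h1]
    unfold blobs compSum
    rw [← sum_sub_distrib]
    refine sum_congr rfl fun v _ => ?_
    by_cases h : G₀.Reachable r v
    · simp [h, h.mono hG.le]
    · simp [h]
  have h2 : ∀ v, (if G.Reachable r v ∧ ¬ G₀.Reachable r v then 1 / compSize G₀ v else 0) =
      ∑ e : V × V, if NewAdj G₀ G e.1 e.2 ∧ (G.deleteEdges {s(e.1, e.2)}).Reachable r e.1 ∧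
        G₀.Reachable e.2 v then 1 / compSize G₀ v else 0 := by
    intro v
    split_ifs with h
    · obtain ⟨e, he, hu⟩ := hG.existsUnique_entering_edge h.1 h.2
      rw [sum_eq_single e]
      · rw [if_pos he]
      · intro e' _ hne
        rw [if_neg fun h' => hne (hu e' h')]
      · simp
    · refine (sum_eq_zero fun e _ => if_neg ?_).symm
      rintro ⟨hn, hr, hv⟩
      refine h ⟨?_, fun h0 => ?_⟩
      · exact (hr.mono (SimpleGraph.deleteEdges_le _)).trans
          (hn.1.reachable.trans (hv.mono hG.le))
      · exact hG.not_reachable hn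
          (hr.symm.trans ((h0.trans hv.symm).mono (hG.le_deleteEdges hn)))
  rw [h1, sum_congr rfl fun v _ => h2 v]
  conv_rhs => rw [sum_comm, Fintype.sum_prod_type]
  refine sum_congr rfl fun x _ => sum_congr rfl fun y _ => ?_
  by_cases hn : NewAdj G₀ G x y
  · by_cases hr : (G.deleteEdges {s(x, y)}).Reachable r x
    · simpa [hn, hr, compSum] using (compSum_inv_compSize G₀ y).symm
    · simp [hr]
  · simp [hn]

/-- The number of new edges at `x`. -/
noncomputable def newDegree (G₀ G : SimpleGraph V) (x : V) : ℝ :=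
  ∑ y, if NewAdj G₀ G x y then 1 else 0

theorem IsBridgeExt.compSum_newDegree {G : SimpleGraph V} (hG : IsBridgeExt G₀ G) (r : V) :
    compSum G (newDegree G₀ G) r = 2 * (blobs G₀ G r - 1) := by
  have h1 := hG.sum_entering r
  have h2 := h1
  rw [sum_comm] at h2
  rw [two_mul]
  nth_rw 1 [← h1]
  rw [← h2, ← sum_add_distrib]
  unfold compSum newDegree
  refine sum_congr rfl fun x _ => ?_
  rw [← sum_add_distrib, ← mul_one (∑ y, _), ← mul_ite_zero, sum_mul]
  refine sum_congr rfl fun y _ => ?_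
  by_cases hn : NewAdj G₀ G x y
  · have hnr := hG.not_reachable hn
    have hr := reachable_iff_deleteEdges hn.1 r x
    have hrefl := SimpleGraph.Reachable.refl (G := G.deleteEdges {s(x, y)}) x
    have hexcl : ¬ ((G.deleteEdges {s(x, y)}).Reachable r x ∧
        (G.deleteEdges {s(x, y)}).Reachable r y) := fun h => hnr (h.1.symm.trans h.2)
    have hyx : ¬ (G.deleteEdges {s(x, y)}).Reachable y x := fun h => hnr h.symm
    rw [if_pos hn, if_pos hn, if_pos hn.symm, Sym2.eq_swap (a := y) (b := x)]
    by_cases h1 : (G.deleteEdges {s(x, y)}).Reachable r x <;>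
      by_cases h2 : (G.deleteEdges {s(x, y)}).Reachable r y <;> simp_all
  · have hn' : ¬ NewAdj G₀ G y x := fun h => hn h.symm
    simp [hn, hn']

end

section

variable {V : Type*} [Fintype V]

/-- The bridge extensions of `G₀` with exactly `c` connected components. -/
noncomputable def extFamily (G₀ : SimpleGraph V) (c : ℕ) : Finset (SimpleGraph V) :=
  univ.filter fun G => IsBridgeExt G₀ G ∧ Nat.card G.ConnectedComponent = c

theorem mem_extFamily {G₀ G : SimpleGraph V} {c : ℕ} :
    G ∈ extFamily G₀ c ↔ IsBridgeExt G₀ G ∧ Nat.card G.ConnectedComponent = c := by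
  simp [extFamily]

/-- Adding an edge between two components is inverse to removing a new edge. -/
theorem sum_sup_edge_eq_sum_newAdj (G₀ : SimpleGraph V) (c : ℕ)
    (φ : SimpleGraph V → SimpleGraph V → V → V → ℝ) :
    ∑ H ∈ extFamily G₀ (c + 1), ∑ x, ∑ y,
        (if H.Reachable x y then 0 else φ H (H ⊔ SimpleGraph.edge x y) x y) =
      ∑ G ∈ extFamily G₀ c, ∑ x, ∑ y,
        if NewAdj G₀ G x y then φ (G.deleteEdges {s(x, y)}) G x y else 0 := by
  rw [sum_comm, sum_comm (s := extFamily G₀ c)]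
  refine sum_congr rfl fun x _ => ?_
  rw [sum_comm, sum_comm (s := extFamily G₀ c)]
  refine sum_congr rfl fun y _ => ?_
  simp_rw [← ite_not (p := SimpleGraph.Reachable _ x y)]
  rw [← sum_filter, ← sum_filter]
  refine sum_bij' (fun H _ => H ⊔ SimpleGraph.edge x y) (fun G _ => G.deleteEdges {s(x, y)})
    ?_ ?_ ?_ ?_ ?_
  · intro H hH
    simp only [mem_filter, mem_extFamily] at hH ⊢
    obtain ⟨⟨hH, hc⟩, hr⟩ := hH
    have := card_connectedComponent_sup_edge hr
    exact ⟨⟨hH.sup_edge hr, by omega⟩, newAdj_sup_edge hH hr⟩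
  · intro G hG
    simp only [mem_filter, mem_extFamily] at hG ⊢
    obtain ⟨⟨hG, hc⟩, hn⟩ := hG
    have hr := hG.not_reachable hn
    have := card_connectedComponent_sup_edge hr
    rw [deleteEdges_sup_edge hn.1] at this
    exact ⟨⟨hG.deleteEdges hn, by omega⟩, hr⟩
  · intro H hH
    simp only [mem_filter, mem_extFamily] at hH
    exact sup_edge_deleteEdges fun h => hH.2 h.reachable
  · intro G hG
    simp only [mem_filter, mem_extFamily] at hG
    exact deleteEdges_sup_edge hG.2.1
  · intro H hH
    simp only [mem_filter, mem_extFamily] at hH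
    rw [sup_edge_deleteEdges fun h => hH.2 h.reachable]

/-- Counting new edges with the size of the side of their tail amounts to counting, for every
root, the new edges directed away from the root. -/
theorem IsBridgeExt.sum_newAdj_compSize_mul {G₀ G : SimpleGraph V} (hG : IsBridgeExt G₀ G)
    {ψ : V → ℝ} (hψ : ∀ x y, G.Reachable x y → ψ x = ψ y) :
    ∑ x, ∑ y, (if NewAdj G₀ G x y then compSize (G.deleteEdges {s(x, y)}) x * ψ x else 0) =
      ∑ r, (blobs G₀ G r - 1) * ψ r := by
  have : ∀ r, (blobs G₀ G r - 1) * ψ r = ∑ x, ∑ y, (if NewAdj G₀ G x y then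
      (if (G.deleteEdges {s(x, y)}).Reachable x r then ψ x else 0) else 0) := by
    intro r
    rw [← hG.sum_entering r, sum_mul]
    refine sum_congr rfl fun x _ => ?_
    rw [sum_mul]
    refine sum_congr rfl fun y _ => ?_
    by_cases hr : (G.deleteEdges {s(x, y)}).Reachable r x
    · simp only [if_pos hr, if_pos hr.symm, ite_mul, one_mul, zero_mul]
      rw [hψ r x (hr.mono (SimpleGraph.deleteEdges_le _))]
    · have hr' : ¬ (G.deleteEdges {s(x, y)}).Reachable x r := fun h => hr h.symm
      simp [hr, hr']
  rw [sum_congr rfl fun r _ => this r]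
  conv_rhs => rw [sum_comm]
  refine sum_congr rfl fun x _ => ?_
  conv_rhs => rw [sum_comm]
  refine sum_congr rfl fun y _ => ?_
  split_ifs
  · rw [compSize, compSum, sum_mul]
    refine sum_congr rfl fun r _ => ?_
    simp
  · simp

/-- The sum of `φ` over all bridge extensions with `c + 1` components and all ordered pairs of
vertices in distinct components. -/
noncomputable def pairSum (G₀ : SimpleGraph V) (c : ℕ) (φ : SimpleGraph V → V → V → ℝ) : ℝ :=
  ∑ H ∈ extFamily G₀ (c + 1), ∑ x, ∑ y, if H.Reachable x y then 0 else φ H x y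

section PairSum

variable {G₀ : SimpleGraph V} {c : ℕ} {φ ψ : SimpleGraph V → V → V → ℝ}

theorem pairSum_le (h : ∀ H, IsBridgeExt G₀ H → ∀ x y, φ H x y ≤ ψ H x y) :
    pairSum G₀ c φ ≤ pairSum G₀ c ψ := by
  unfold pairSum
  refine sum_le_sum fun H hH => sum_le_sum fun x _ => sum_le_sum fun y _ => ?_
  split_ifs
  exacts [le_rfl, h H (mem_extFamily.1 hH).1 x y]

theorem pairSum_congr (h : ∀ H, IsBridgeExt G₀ H → ∀ x y, φ H x y = ψ H x y) :
    pairSum G₀ c φ = pairSum G₀ c ψ :=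
  le_antisymm (pairSum_le fun H hH x y => (h H hH x y).le)
    (pairSum_le fun H hH x y => (h H hH x y).ge)

theorem pairSum_add : pairSum G₀ c (fun H x y => φ H x y + ψ H x y) =
    pairSum G₀ c φ + pairSum G₀ c ψ := by
  unfold pairSum
  simp_rw [← sum_add_distrib]
  refine sum_congr rfl fun H hH => sum_congr rfl fun x _ => sum_congr rfl fun y _ => ?_
  split_ifs <;> simp

theorem pairSum_const_mul (a : ℝ) : pairSum G₀ c (fun H x y => a * φ H x y) =
    a * pairSum G₀ c φ := by
  unfold pairSum
  simp_rw [mul_sum]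
  refine sum_congr rfl fun H hH => sum_congr rfl fun x _ => sum_congr rfl fun y _ => ?_
  split_ifs <;> simp

theorem pairSum_swap : pairSum G₀ c (fun H x y => φ H y x) = pairSum G₀ c φ := by
  unfold pairSum
  refine sum_congr rfl fun H hH => ?_
  rw [sum_comm]
  refine sum_congr rfl fun x _ => sum_congr rfl fun y _ => ?_
  simp only [H.reachable_comm (u := y) (v := x)]

theorem pairSum_eq_of_symm
    (h : ∀ H, IsBridgeExt G₀ H → ∀ x y, φ H x y + φ H y x = ψ H x y + ψ H y x) :
    pairSum G₀ c φ = pairSum G₀ c ψ := by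
  have h1 := pairSum_congr (c := c) h
  rw [pairSum_add, pairSum_add, pairSum_swap (φ := φ), pairSum_swap (φ := ψ)] at h1
  linarith

/-- Averaging over the component of the first vertex. -/
theorem pairSum_average (a : SimpleGraph V → V → ℝ) {b : SimpleGraph V → V → V → ℝ}
    (hb : ∀ H x x' y, H.Reachable x x' → b H x y = b H x' y) :
    pairSum G₀ c (fun H x y => compSum H (a H) x / compSize H x * b H x y) =
      pairSum G₀ c (fun H x y => a H x * b H x y) := by
  unfold pairSum
  refine sum_congr rfl fun H _ => ?_
  have := sum_compSum_div_mul (G := H) (b := fun x => ∑ y, if H.Reachable x y then 0 else b H x y)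
    (fun x x' hx => sum_congr rfl fun y _ => ?_) (a H)
  · simp_rw [mul_sum, mul_ite, mul_zero] at this
    exact this
  · have hiff : H.Reachable x y ↔ H.Reachable x' y := ⟨hx.symm.trans, hx.trans⟩
    simp only [hiff, hb H x x' y hx]

/-- Summing over pairs a quantity that depends only on the component obtained by joining them. -/
theorem pairSum_compSize_mul (f : ℝ → ℝ → ℝ) :
    pairSum G₀ c (fun H x y => compSize H x *
      f (compSize H x + compSize H y) (blobs G₀ H x + blobs G₀ H y)) =
    ∑ G ∈ extFamily G₀ c, ∑ r, (blobs G₀ G r - 1) * f (compSize G r) (blobs G₀ G r) := by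
  have h1 := sum_sup_edge_eq_sum_newAdj G₀ c
    fun H G x _ => compSize H x * f (compSize G x) (blobs G₀ G x)
  refine Eq.trans ?_ (h1.trans ?_)
  · unfold pairSum
    refine sum_congr rfl fun H hH => sum_congr rfl fun x _ => sum_congr rfl fun y _ => ?_
    split_ifs with h
    · rfl
    · unfold compSize blobs
      rw [compSum_sup_edge_left h, compSum_sup_edge_left h]
  · refine sum_congr rfl fun G hG => ?_
    exact (mem_extFamily.1 hG).1.sum_newAdj_compSize_mul
      (ψ := fun x => f (compSize G x) (blobs G₀ G x))
      fun x y h => by rw [compSize_congr h, blobs_congr h]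

/-- Each cherry of new edges is obtained by joining three components; averaging over the three
choices of the centre. -/
theorem pairSum_newDegree :
    pairSum G₀ c (fun H x _ => newDegree G₀ H x) =
      3 * pairSum G₀ c (fun H x y => (blobs G₀ H x - 1) * (1 / (compSize H x + compSize H y))) := by
  set T : SimpleGraph V → V → V → V → ℝ := fun H x z y =>
    if H.Reachable x z ∨ H.Reachable x y ∨ H.Reachable z y then 0 else 1 with hT
  set S : SimpleGraph V → V → V → V → ℝ := fun H x z y =>
    compSize H x + compSize H z + compSize H y with hS
  have reach : ∀ (H : SimpleGraph V) (x z y : V), (H ⊔ SimpleGraph.edge x z).Reachable x y ↔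
      H.Reachable x y ∨ H.Reachable z y := by
    intro H x z y
    rw [reachable_sup_edge_iff]
    have := SimpleGraph.Reachable.refl (G := H) x
    tauto
  have lhs : pairSum G₀ c (fun H x _ => newDegree G₀ H x) =
      ∑ H ∈ extFamily G₀ (c + 1 + 1), ∑ x, ∑ z, ∑ y, T H x z y := by
    have h1 := sum_sup_edge_eq_sum_newAdj G₀ (c + 1)
      fun _ G x _ => ∑ y, if G.Reachable x y then 0 else 1
    refine Eq.trans ?_ (h1.symm.trans ?_)
    · unfold pairSum newDegree
      refine sum_congr rfl fun H hH => sum_congr rfl fun x _ => ?_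
      have : ∀ y, (if H.Reachable x y then 0 else ∑ z, if NewAdj G₀ H x z then (1 : ℝ) else 0) =
          ∑ z, if NewAdj G₀ H x z then (if H.Reachable x y then 0 else 1) else 0 := by
        intro y
        split_ifs <;> simp
      rw [sum_congr rfl fun y _ => this y, sum_comm]
      refine sum_congr rfl fun z _ => ?_
      split_ifs <;> simp
    · refine sum_congr rfl fun H hH => sum_congr rfl fun x _ => sum_congr rfl fun z _ => ?_
      split_ifs with h
      · simp [hT, h]
      · simp only [hT, reach, h, false_or]
  have rhs : pairSum G₀ c (fun H x y =>
      (blobs G₀ H x - 1) * (1 / (compSize H x + compSize H y))) =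
      ∑ H ∈ extFamily G₀ (c + 1 + 1), ∑ x, ∑ z, ∑ y, T H x z y * (compSize H x / S H x z y) := by
    have h1 := sum_sup_edge_eq_sum_newAdj G₀ (c + 1) fun H G x _ => compSize H x *
      ∑ y, if G.Reachable x y then 0 else 1 / (compSize G x + compSize G y)
    refine Eq.trans ?_ (h1.symm.trans ?_)
    · unfold pairSum
      refine sum_congr rfl fun H hH => ?_
      rw [(mem_extFamily.1 hH).1.sum_newAdj_compSize_mul
        (ψ := fun x => ∑ y, if H.Reachable x y then 0 else 1 / (compSize H x + compSize H y))]
      · simp_rw [mul_sum, mul_ite, mul_zero]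
      · intro x x' hx
        refine sum_congr rfl fun y _ => ?_
        have hiff : H.Reachable x y ↔ H.Reachable x' y := ⟨hx.symm.trans, hx.trans⟩
        simp only [hiff, compSize_congr hx]
    · refine sum_congr rfl fun H hH => sum_congr rfl fun x _ => sum_congr rfl fun z _ => ?_
      split_ifs with h
      · simp [hT, h]
      · rw [mul_sum]
        refine sum_congr rfl fun y _ => ?_
        by_cases hxy : H.Reachable x y
        · simp [hT, reach, hxy]
        by_cases hzy : H.Reachable z y
        · simp [hT, reach, hzy]
        have e1 : compSize (H ⊔ SimpleGraph.edge x z) x = compSize H x + compSize H z :=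
          compSum_sup_edge_left h _
        have e2 : compSize (H ⊔ SimpleGraph.edge x z) y = compSize H y :=
          compSum_sup_edge_of_not_reachable hxy hzy _
        simp only [hT, hS, reach, h, hxy, hzy, e1, e2, or_self, if_false]
        ring
  have split : ∀ H : SimpleGraph V, ∑ x, ∑ z, ∑ y, T H x z y =
      3 * ∑ x, ∑ z, ∑ y, T H x z y * (compSize H x / S H x z y) := by
    intro H
    have swap1 : ∑ x, ∑ z, ∑ y, T H x z y * (compSize H z / S H x z y) =
        ∑ x, ∑ z, ∑ y, T H x z y * (compSize H x / S H x z y) := by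
      rw [sum_comm]
      refine sum_congr rfl fun x _ => sum_congr rfl fun z _ => sum_congr rfl fun y _ => ?_
      have e1 : T H z x y = T H x z y := by
        simp only [hT, H.reachable_comm (u := z) (v := x)]
        congr 1
        exact propext (by tauto)
      have e2 : S H z x y = S H x z y := by simp only [hS]; ring
      rw [e1, e2]
    have swap2 : ∑ x, ∑ z, ∑ y, T H x z y * (compSize H y / S H x z y) =
        ∑ x, ∑ z, ∑ y, T H x z y * (compSize H z / S H x z y) := by
      refine sum_congr rfl fun x _ => ?_
      rw [sum_comm]
      refine sum_congr rfl fun z _ => sum_congr rfl fun y _ => ?_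
      have e1 : T H x y z = T H x z y := by
        simp only [hT, H.reachable_comm (u := y) (v := z)]
        congr 1
        exact propext (by tauto)
      have e2 : S H x y z = S H x z y := by simp only [hS]; ring
      rw [e1, e2]
    have total : ∑ x, ∑ z, ∑ y, T H x z y =
        ∑ x, ∑ z, ∑ y, T H x z y * (compSize H x / S H x z y) +
        ∑ x, ∑ z, ∑ y, T H x z y * (compSize H z / S H x z y) +
        ∑ x, ∑ z, ∑ y, T H x z y * (compSize H y / S H x z y) := by
      simp_rw [← sum_add_distrib]
      refine sum_congr rfl fun x _ => sum_congr rfl fun z _ => sum_congr rfl fun y _ => ?_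
      have := compSize_pos H x
      have := compSize_pos H y
      have := compSize_pos H z
      have hpos : S H x z y ≠ 0 := by simp only [hS]; positivity
      rw [← mul_add, ← mul_add, ← add_div, ← add_div, div_self hpos, mul_one]
    rw [total, swap2, swap1]
    ring
  rw [lhs, rhs, mul_sum]
  exact sum_congr rfl fun H _ => split H

theorem pairSum_inv_compSize : pairSum G₀ c (fun H x _ => 1 / compSize H x) =
    Fintype.card V * c * (extFamily G₀ (c + 1)).card := by
  unfold pairSum
  rw [card_eq_sum_ones, Nat.cast_sum, mul_sum]
  refine sum_congr rfl fun H hH => ?_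
  have h1 : ∀ x, (∑ y, if H.Reachable x y then 0 else 1 / compSize H x) =
      Fintype.card V * (1 / compSize H x) - 1 := by
    intro x
    have h2 : (∑ y, if H.Reachable x y then 0 else 1 / compSize H x) =
        ∑ y : V, (1 / compSize H x - (if H.Reachable x y then 1 else 0) * (1 / compSize H x)) := by
      refine sum_congr rfl fun y _ => ?_
      split_ifs <;> simp
    rw [h2, sum_sub_distrib, ← sum_mul]
    change _ - compSize H x * _ = _
    rw [mul_one_div_cancel (compSize_pos H x).ne']
    simp
  rw [sum_congr rfl fun x _ => h1 x, sum_sub_distrib, ← mul_sum, sum_inv_compSize,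
    (mem_extFamily.1 hH).2]
  simp
  ring

end PairSum

/-- The ratio of the numbers of bridge extensions with `c + 1` and with `c` components. -/
theorem card_extFamily_succ_le (G₀ : SimpleGraph V) (c : ℕ) :
    (Fintype.card V * c * (extFamily G₀ (c + 1)).card : ℝ) ≤
      (Fintype.card V / 2 + 3 * c) * (extFamily G₀ c).card := by
  -- the sum over components of the average of `1 / compSize` splits by `1 = vertices - edges`
  have e1 : pairSum G₀ c (fun H x _ => 1 / compSize H x) =
      pairSum G₀ c (fun _ x _ => 1 / compSize G₀ x) -
        1 / 2 * pairSum G₀ c (fun H x _ => newDegree G₀ H x) := by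
    have a1 := pairSum_average (G₀ := G₀) (c := c) (fun _ x => 1 / compSize G₀ x)
      (b := fun _ _ _ => 1) (fun _ _ _ _ _ => rfl)
    have a2 := pairSum_average (G₀ := G₀) (c := c) (fun H x => newDegree G₀ H x)
      (b := fun _ _ _ => 1) (fun _ _ _ _ _ => rfl)
    simp only [mul_one] at a1 a2
    rw [← a1, ← a2, ← pairSum_const_mul, eq_sub_iff_add_eq, ← pairSum_add]
    refine pairSum_congr fun H hH x y => ?_
    rw [hH.compSum_newDegree]
    unfold blobs
    ring
  have e2 : pairSum G₀ c (fun _ x _ => 1 / compSize G₀ x) ≤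
      pairSum G₀ c (fun H x y => blobs G₀ H x / (compSize H x + compSize H y)) +
        pairSum G₀ c (fun H x y => compSize H y / (compSize H x + compSize H y)) := by
    have a1 := pairSum_average (G₀ := G₀) (c := c) (fun _ x => 1 / compSize G₀ x)
      (b := fun H x y => compSize H x / (compSize H x + compSize H y))
      (fun H x x' y h => by rw [compSize_congr h])
    have a2 : pairSum G₀ c (fun H x y => blobs G₀ H x / (compSize H x + compSize H y)) =
        pairSum G₀ c (fun H x y => 1 / compSize G₀ x *
          (compSize H x / (compSize H x + compSize H y))) := by
      rw [← a1]
      refine pairSum_congr fun H hH x y => ?_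
      have := compSize_pos H x
      unfold blobs
      field_simp
    rw [a2, ← pairSum_add]
    refine pairSum_le fun H hH x y => ?_
    have hx := compSize_pos H x
    have hy := compSize_pos H y
    have h1 := inv_compSize_le_one G₀ x
    have h2 : compSize H x / (compSize H x + compSize H y) =
      1 - compSize H y / (compSize H x + compSize H y) := by field_simp; ring
    have h3 : 0 ≤ compSize H y / (compSize H x + compSize H y) := by positivity
    rw [h2]
    nlinarith
  have e3 : pairSum G₀ c (fun H x y => blobs G₀ H x / (compSize H x + compSize H y)) =
      pairSum G₀ c (fun H x y => compSize H x * ((blobs G₀ H x + blobs G₀ H y) /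
        (compSize H x + compSize H y) ^ 2)) := by
    refine pairSum_eq_of_symm fun H hH x y => ?_
    have hx := compSize_pos H x
    have hy := compSize_pos H y
    rw [add_comm (compSize H y), add_comm (blobs G₀ H y)]
    field_simp
  have e4 : pairSum G₀ c (fun H x y => compSize H y / (compSize H x + compSize H y)) =
      pairSum G₀ c (fun H x y => compSize H x * (1 / (compSize H x + compSize H y))) := by
    refine pairSum_eq_of_symm fun H hH x y => ?_
    rw [add_comm (compSize H y) (compSize H x)]
    ring
  have e5 : pairSum G₀ c (fun H x y =>
        (blobs G₀ H x - 1) * (1 / (compSize H x + compSize H y))) =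
      pairSum G₀ c (fun H x y => compSize H x * ((blobs G₀ H x + blobs G₀ H y - 2) /
        (compSize H x + compSize H y) ^ 2)) := by
    refine pairSum_eq_of_symm fun H hH x y => ?_
    have hx := compSize_pos H x
    have hy := compSize_pos H y
    rw [add_comm (compSize H y), add_comm (blobs G₀ H y)]
    field_simp
    ring
  rw [← pairSum_inv_compSize, e1, pairSum_newDegree, e5,
    pairSum_compSize_mul (fun n k => (k - 2) / n ^ 2)]
  rw [e3, e4, pairSum_compSize_mul (fun n k => k / n ^ 2),
    pairSum_compSize_mul (fun n _ => 1 / n)] at e2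
  have e6 : ∀ G ∈ extFamily G₀ c,
      (∑ r, (blobs G₀ G r - 1) * (blobs G₀ G r / compSize G r ^ 2)) +
      (∑ r, (blobs G₀ G r - 1) * (1 / compSize G r)) -
      3 / 2 * (∑ r, (blobs G₀ G r - 1) * ((blobs G₀ G r - 2) / compSize G r ^ 2)) ≤
      Fintype.card V / 2 + 3 * c := by
    intro G hG
    rw [mem_extFamily] at hG
    have h1 : (Fintype.card V / 2 + 3 * c : ℝ) = ∑ r, (1 / 2 + 3 * (1 / compSize G r)) := by
      rw [sum_add_distrib, ← mul_sum, sum_inv_compSize, hG.2]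
      simp
      ring
    rw [h1, mul_sum, ← sum_add_distrib, ← sum_sub_distrib]
    refine sum_le_sum fun r _ => ?_
    have hn := compSize_pos G r
    have hk := hG.1.one_le_blobs r
    have hkn := blobs_le_compSize G₀ G r
    generalize compSize G r = n at *
    generalize blobs G₀ G r = k at *
    rw [← sub_nonneg]
    have : 1 / 2 + 3 * (1 / n) - ((k - 1) * (k / n ^ 2) + (k - 1) * (1 / n) -
        3 / 2 * ((k - 1) * ((k - 2) / n ^ 2))) =
        ((n - k) ^ 2 / 2 + 3 * (n - k) + (n - k / 2 + 3)) / n ^ 2 := by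
      field_simp
      ring
    rw [this]
    apply div_nonneg _ (by positivity)
    nlinarith [sq_nonneg (n - k)]
  have e7 := sum_le_sum e6
  rw [sum_sub_distrib, sum_add_distrib, ← mul_sum, sum_const, nsmul_eq_mul] at e7
  linarith

end

section

/-- The graph obtained by removing all bridges. -/
def core {V : Type*} (G : SimpleGraph V) : SimpleGraph V := G.deleteEdges {e | G.IsBridge e}

section Core

variable {V : Type*} {G G₀ : SimpleGraph V}

theorem core_adj {x y : V} : (core G).Adj x y ↔ G.Adj x y ∧ ¬ G.IsBridge s(x, y) := by
  simp [core, SimpleGraph.deleteEdges_adj]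

theorem isBridgeExt_core (G : SimpleGraph V) : IsBridgeExt (core G) G where
  le := SimpleGraph.deleteEdges_le _
  isBridge x y h h0 := by
    rw [core_adj] at h0
    tauto

theorem not_isBridge_core {x y : V} (h : (core G).Adj x y) : ¬ (core G).IsBridge s(x, y) := by
  have h' := (core_adj.1 h).2
  rw [SimpleGraph.isBridge_iff_forall_cycle_notMem (core_adj.1 h).1] at h'
  push Not at h'
  obtain ⟨u, p, hp, he⟩ := h'
  have hmem : ∀ e ∈ p.edges, e ∈ (core G).edgeSet := by
    intro e hep
    have h1 := p.edges_subset_edgeSet hep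
    have h2 : ¬ G.IsBridge e := fun hb => hb.notMem_edges_of_isCycle hp hep
    induction e with | h a b => exact core_adj.2 ⟨h1, h2⟩
  intro hb
  refine hb.notMem_edges_of_isCycle (hp.transfer hmem) ?_
  rwa [SimpleGraph.Walk.edges_transfer]

theorem core_eq_of_isBridgeExt {G' : SimpleGraph V} (h : IsBridgeExt (core G) G') :
    core G' = core G := by
  ext x y
  constructor
  · intro hxy
    by_contra h0
    exact (core_adj.1 hxy).2 (h.isBridge x y (core_adj.1 hxy).1 h0)
  · intro hxy
    exact core_adj.2 ⟨h.le hxy, fun hb => not_isBridge_core hxy (hb.anti h.le)⟩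

end Core

theorem mem_iff_of_isBridgeExt {n : ℕ} {A : Set (SimpleGraph (Fin n))} (hA : BridgeAlterable A)
    {G₀ G : SimpleGraph (Fin n)} (h : IsBridgeExt G₀ G) : G ∈ A ↔ G₀ ∈ A := by
  induction G using WellFoundedLT.induction with
  | ind G ih =>
    by_cases hne : G ≤ G₀
    · rw [le_antisymm hne h.le]
    · obtain ⟨x, y, hxy, h0⟩ : ∃ x y, G.Adj x y ∧ ¬ G₀.Adj x y := by
        by_contra! hcon
        exact hne fun x y hxy => hcon x y hxy
      have hlt : G.deleteEdges {s(x, y)} < G := by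
        refine lt_of_le_of_ne (SimpleGraph.deleteEdges_le _) fun he => ?_
        rw [← he] at hxy
        simp at hxy
      rw [hA G _ (h.isBridge x y hxy h0), ih _ hlt (h.deleteEdges ⟨hxy, h0⟩)]

theorem connected_of_card_eq_one {V : Type*} [Nonempty V] {G : SimpleGraph V}
    (h : Nat.card G.ConnectedComponent = 1) : G.Connected := by
  have := (Nat.card_eq_one_iff_unique.1 h).1
  exact (SimpleGraph.connected_iff G).2
    ⟨fun x y => SimpleGraph.ConnectedComponent.exact (Subsingleton.elim _ _), ‹_›⟩

/-- The bound for the number of bridge extensions of a graph on `n` vertices with `j + 1`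
components, relative to the connected ones. -/
noncomputable def ratioBound (n j : ℕ) : ℝ :=
  ∏ i ∈ range j, (1 / 2 + 3 * (i + 1) / n) / (i + 1 : ℝ)

theorem ratioBound_nonneg (n j : ℕ) : 0 ≤ ratioBound n j := prod_nonneg fun _ _ => by positivity

theorem card_extFamily_le {V : Type*} [Fintype V] [Nonempty V] (G₀ : SimpleGraph V) (j : ℕ) :
    ((extFamily G₀ (j + 1)).card : ℝ) ≤
      ratioBound (Fintype.card V) j * (extFamily G₀ 1).card := by
  induction j with
  | zero => simp [ratioBound]
  | succ j ih =>
    have hn : (0 : ℝ) < Fintype.card V := by exact_mod_cast Fintype.card_pos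
    have h := card_extFamily_succ_le G₀ (j + 1)
    push_cast at h
    set n : ℝ := (Fintype.card V : ℝ)
    have hj : (0 : ℝ) < j + 1 := by positivity
    have h1 : ((extFamily G₀ (j + 1 + 1)).card : ℝ) ≤
        (1 / 2 + 3 * (j + 1) / n) / (j + 1) * (extFamily G₀ (j + 1)).card := by
      have e : (1 / 2 + 3 * (j + 1) / n) / (j + 1) * (extFamily G₀ (j + 1)).card =
          (n / 2 + 3 * (j + 1)) * (extFamily G₀ (j + 1)).card / (n * (j + 1)) := by
        field_simp
      rw [e, le_div_iff₀ (by positivity)]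
      linarith
    refine h1.trans ?_
    rw [ratioBound, prod_range_succ, mul_comm (∏ i ∈ range j, _), mul_assoc]
    exact mul_le_mul_of_nonneg_left ih (by positivity)

theorem card_isBridgeExt_le {V : Type*} [Fintype V] [Nonempty V] (G₀ : SimpleGraph V) :
    ((univ.filter fun G => IsBridgeExt G₀ G).card : ℝ) ≤
      (∑ j ∈ range (Fintype.card V), ratioBound (Fintype.card V) j) *
        (extFamily G₀ 1).card := by
  have h1 : (univ.filter fun G => IsBridgeExt G₀ G) ⊆
      (range (Fintype.card V)).biUnion fun j => extFamily G₀ (j + 1) := by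
    intro G hG
    rw [mem_filter] at hG
    have hle : Nat.card G.ConnectedComponent ≤ Fintype.card V := by
      rw [← Nat.card_eq_fintype_card]
      exact Nat.card_le_card_of_surjective G.connectedComponentMk Quot.mk_surjective
    have hpos : 0 < Nat.card G.ConnectedComponent := by
      have : Nonempty G.ConnectedComponent := Nonempty.map G.connectedComponentMk ‹_›
      exact Nat.card_pos
    rw [mem_biUnion]
    exact ⟨Nat.card G.ConnectedComponent - 1, mem_range.2 (by omega),
      mem_extFamily.2 ⟨hG.2, by omega⟩⟩
  have h2 : ((univ.filter fun G => IsBridgeExt G₀ G).card : ℝ) ≤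
      ∑ j ∈ range (Fintype.card V), ((extFamily G₀ (j + 1)).card : ℝ) := by
    exact_mod_cast (card_le_card h1).trans card_biUnion_le
  rw [sum_mul]
  exact h2.trans (sum_le_sum fun j _ => card_extFamily_le G₀ j)

theorem factorial_eq_prod_cast (j : ℕ) : (j.factorial : ℝ) = ∏ i ∈ range j, ((i : ℝ) + 1) := by
  rw [← prod_range_add_one_eq_factorial, Nat.cast_prod]
  exact prod_congr rfl fun i _ => Nat.cast_succ i

theorem ratioBound_le {n j : ℕ} (h : j ≤ n) :
    ratioBound n j ≤ (7 / 2) ^ j / (j.factorial : ℝ) := by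
  have h1 : ((7 / 2) ^ j / (j.factorial : ℝ) : ℝ) =
      ∏ i ∈ range j, (7 / 2 : ℝ) / (i + 1 : ℝ) := by
    rw [prod_div_distrib, prod_const, card_range, factorial_eq_prod_cast]
  rw [h1, ratioBound]
  refine prod_le_prod (fun i _ => by positivity) fun i hi => ?_
  rw [mem_range] at hi
  have hn : (0 : ℝ) < n := by exact_mod_cast (by omega : 0 < n)
  have h2 : ((i : ℝ) + 1) ≤ n := by exact_mod_cast (by omega : i + 1 ≤ n)
  have h3 : 3 * ((i : ℝ) + 1) / n ≤ 3 := by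
    rw [div_le_iff₀ hn]
    linarith
  gcongr
  linarith

open Filter Topology in
theorem tendsto_ratioBound (j : ℕ) :
    Tendsto (fun n => ratioBound n j) atTop (𝓝 ((1 / 2) ^ j / (j.factorial : ℝ))) := by
  have h1 : ((1 / 2) ^ j / (j.factorial : ℝ) : ℝ) =
      ∏ i ∈ range j, (1 / 2 + 0 : ℝ) / (i + 1 : ℝ) := by
    rw [prod_div_distrib, prod_const, card_range, add_zero, factorial_eq_prod_cast]
  rw [h1]
  unfold ratioBound
  refine tendsto_finsetProd _ fun i _ => Tendsto.div_const (Tendsto.const_add _ ?_) _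
  exact tendsto_const_div_atTop_nhds_zero_nat _

open Filter Topology in
theorem tendsto_sum_ratioBound :
    Tendsto (fun n => ∑ j ∈ range n, ratioBound n j) atTop (𝓝 (Real.exp (1 / 2))) := by
  have h := tendsto_tsum_of_dominated_convergence (𝓕 := atTop)
    (f := fun n j => if j ∈ range n then ratioBound n j else 0)
    (g := fun j => (1 / 2) ^ j / (j.factorial : ℝ))
    (bound := fun j => (7 / 2) ^ j / (j.factorial : ℝ))
    (Real.summable_pow_div_factorial _) (fun j => ?_) (Eventually.of_forall fun n j => ?_)
  · have e1 : Real.exp (1 / 2) = ∑' j : ℕ, (1 / 2) ^ j / (j.factorial : ℝ) := by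
      rw [Real.exp_eq_exp_ℝ, NormedSpace.exp_eq_tsum_div]
    rw [e1]
    refine h.congr fun n => ?_
    rw [tsum_eq_sum (s := range n) fun j hj => if_neg hj]
    exact sum_congr rfl fun j hj => if_pos hj
  · refine (tendsto_ratioBound j).congr' ?_
    filter_upwards [eventually_gt_atTop j] with n hn
    rw [if_pos (mem_range.2 hn)]
  · split_ifs with hj
    · rw [Real.norm_of_nonneg (ratioBound_nonneg n j)]
      exact ratioBound_le (mem_range.1 hj).le
    · rw [norm_zero]
      positivity

theorem ncard_le_sum_ratioBound_mul {V : Type*} [Fintype V] [Nonempty V]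
    {A : Set (SimpleGraph V)} (hA : ∀ G₀ G, IsBridgeExt G₀ G → (G ∈ A ↔ G₀ ∈ A)) :
    (A.ncard : ℝ) ≤ (∑ j ∈ range (Fintype.card V), ratioBound (Fintype.card V) j) *
      ({G ∈ A | G.Connected}.ncard : ℝ) := by
  set B : Finset (SimpleGraph V) := univ.filter (· ∈ A) with hB
  set C : Finset (SimpleGraph V) := B.filter (·.Connected) with hC
  have h1 : A.ncard = B.card := by
    rw [← Set.ncard_coe_finset]
    congr 1
    ext
    simp [hB]
  have h2 : {G ∈ A | G.Connected}.ncard = C.card := by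
    rw [← Set.ncard_coe_finset]
    congr 1
    ext
    simp [hB, hC]
  have mapB : ∀ G ∈ B, core G ∈ B.image core := fun G hG => mem_image_of_mem _ hG
  have mapC : ∀ G ∈ C, core G ∈ B.image core := fun G hG => mapB G (mem_filter.1 hG).1
  rw [h1, h2, card_eq_sum_card_fiberwise mapB, card_eq_sum_card_fiberwise mapC]
  push_cast
  rw [mul_sum]
  refine sum_le_sum fun G₀ hG₀ => ?_
  obtain ⟨G₁, hG₁, rfl⟩ := mem_image.1 hG₀
  have hmem : ∀ G, IsBridgeExt (core G₁) G → G ∈ A := fun G hG => by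
    rw [hA _ _ hG, ← hA _ _ (isBridgeExt_core G₁)]
    simpa [hB] using hG₁
  have hbound := card_isBridgeExt_le (core G₁)
  refine le_trans ?_ (hbound.trans ?_)
  · refine Nat.cast_le.2 (card_le_card fun G hG => ?_)
    rw [mem_filter] at hG
    have h := isBridgeExt_core G
    rw [hG.2] at h
    exact mem_filter.2 ⟨mem_univ _, h⟩
  · refine mul_le_mul_of_nonneg_left (Nat.cast_le.2 (card_le_card fun G hG => ?_))
      (sum_nonneg fun j _ => ratioBound_nonneg _ j)
    rw [mem_extFamily] at hG
    simp only [hC, hB, mem_filter, mem_univ, true_and]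
    exact ⟨⟨hmem G hG.1, connected_of_card_eq_one hG.2⟩, core_eq_of_isBridgeExt hG.1⟩

end

end BridgeExtension

open BridgeExtension in
theorem connected_prob_ge_asymptotic (ε : ℝ) (hε : 0 < ε) :
    ∃ N : ℕ, ∀ n : ℕ, N ≤ n →
      ∀ A : Set (SimpleGraph (Fin n)), A.Nonempty → BridgeAlterable A →
        Real.exp (-(1 / 2) - ε)
          ≤ ({G ∈ A | G.Connected}.ncard : ℝ) / (A.ncard : ℝ) := by
  have hlt : Real.exp (1 / 2) < Real.exp (1 / 2 + ε) := Real.exp_lt_exp.2 (by linarith)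
  obtain ⟨N, hN⟩ := Filter.eventually_atTop.1
    ((tendsto_sum_ratioBound.eventually_lt_const hlt).and (Filter.eventually_gt_atTop 0))
  refine ⟨N, fun n hn A hne hA => ?_⟩
  obtain ⟨hS, hpos⟩ := hN n hn
  have hcard : (0 : ℝ) < A.ncard := by exact_mod_cast (Set.ncard_pos (Set.toFinite A)).2 hne
  have : Nonempty (Fin n) := ⟨⟨0, hpos⟩⟩
  have hmain := ncard_le_sum_ratioBound_mul (A := A) fun _ _ => mem_iff_of_isBridgeExt hA
  rw [Fintype.card_fin] at hmain
  rw [le_div_iff₀ hcard, show -(1 / 2) - ε = -(1 / 2 + ε) by ring, Real.exp_neg,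
    inv_mul_le_iff₀ (Real.exp_pos _)]
  exact hmain.trans (mul_le_mul_of_nonneg_right hS.le (Nat.cast_nonneg _))
end
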